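/- ∫_0^1 K(√(1-t)) [K(√t)]² / (2 t^{3/4} (1-t)^{3/4}) dt = Γ(1/4)⁸ / (32 √2 π²), where K is the complete elliptic integral of the first kind. -/

import Mathlib

open Real MeasureTheory intervalIntegral Complex

/-- Complete elliptic integral of the first kind. -/
noncomputable def ellipticK (k : ℝ) : ℝ :=
  ∫ θ in (0:ℝ)..(π/2), (1 - k ^ 2 * Real.sin θ ^ 2) ^ (-(1/2 : ℝ))

/-- Complete elliptic integral of the second kind. -/
noncomputable def ellipticE (k : ℝ) : ℝ :=
  ∫ θ in (0:ℝ)..(π/2), (1 - k ^ 2 * Real.sin θ ^ 2) ^ ((1/2 : ℝ))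

/-- Legendre function of the first kind of degree ν : P_ν(1-2z) = ₂F₁(-ν, ν+1; 1; z). -/
noncomputable def legendreP (ν : ℂ) (x : ℂ) : ℂ :=
  ordinaryHypergeometric (-ν) (ν + 1) 1 ((1 - x) / 2)


open Real MeasureTheory intervalIntegral Complex
open Filter Topology Set

noncomputable def thk (k : ℕ) (y : ℝ) : ℝ :=
  ∑' n : ℤ, (-(π * (n : ℝ) ^ 2)) ^ k * Real.exp (-(π * (n : ℝ) ^ 2) * y)

lemma thk_summable (k : ℕ) {y : ℝ} (hy : 0 < y) :
    Summable fun n : ℤ => (-(π * (n : ℝ) ^ 2)) ^ k * Real.exp (-(π * (n : ℝ) ^ 2) * y) := by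
  have h := (summable_pow_mul_jacobiTheta₂_term_bound 0 hy (2 * k)).mul_left (π ^ k)
  refine Summable.of_norm (h.congr fun n => ?_)
  rw [norm_mul, norm_pow, norm_neg, Real.norm_of_nonneg (by positivity),
    Real.norm_of_nonneg (Real.exp_pos _).le, mul_pow, pow_mul]
  push_cast
  rw [sq_abs, ← mul_assoc]
  congr 2
  ring

lemma thk_summable_abs (k : ℕ) {y : ℝ} (hy : 0 < y) :
    Summable fun n : ℤ => (π * (n : ℝ) ^ 2) ^ k * Real.exp (-(π * (n : ℝ) ^ 2) * y) := by
  refine (thk_summable k hy).norm.congr fun n => ?_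
  rw [norm_mul, norm_pow, norm_neg, Real.norm_of_nonneg (by positivity),
    Real.norm_of_nonneg (Real.exp_pos _).le]

lemma thk_hasDerivAt (k : ℕ) {y : ℝ} (hy : 0 < y) :
    HasDerivAt (thk k) (thk (k + 1) y) y := by
  have := hasDerivAt_tsum_of_isPreconnected (𝕜 := ℝ) (F := ℝ)
    (g := fun (n : ℤ) y => (-(π * (n : ℝ) ^ 2)) ^ k * Real.exp (-(π * (n : ℝ) ^ 2) * y))
    (g' := fun (n : ℤ) y => (-(π * (n : ℝ) ^ 2)) ^ (k + 1) * Real.exp (-(π * (n : ℝ) ^ 2) * y))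
    (t := Ioi (y / 2)) (thk_summable_abs (k + 1) (half_pos hy)) isOpen_Ioi
    isPreconnected_Ioi ?_ ?_ (y₀ := y) (y := y) (by simp [hy]) (thk_summable k hy) (by simp [hy])
  · exact this
  · intro n z hz
    have := (((hasDerivAt_id z).const_mul (-(π * (n : ℝ) ^ 2))).exp).const_mul
      ((-(π * (n : ℝ) ^ 2)) ^ k)
    convert! this using 1
    simp
    ring
  · intro n z hz
    rw [norm_mul, norm_pow, norm_neg, Real.norm_of_nonneg (by positivity),
      Real.norm_of_nonneg (Real.exp_pos _).le]
    have hz' : y / 2 ≤ z := le_of_lt hz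
    have h0 : 0 ≤ π * (n : ℝ) ^ 2 := by positivity
    refine mul_le_mul_of_nonneg_left (Real.exp_le_exp.2 ?_) (by positivity)
    nlinarith

lemma thk_tendsto (k : ℕ) :
    Tendsto (fun y => Real.exp (π * y) * (thk k y - 0 ^ k)) atTop (𝓝 (2 * (-π) ^ k)) := by
  have h1 : ∀ᶠ y in atTop, Real.exp (π * y) * (thk k y - 0 ^ k) =
      ∑' n : ℤ, if n = 0 then 0 else
        (-(π * (n : ℝ) ^ 2)) ^ k * Real.exp (-(π * ((n : ℝ) ^ 2 - 1)) * y) := by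
    filter_upwards [eventually_gt_atTop 0] with y hy
    rw [thk, (thk_summable k hy).tsum_eq_add_tsum_ite 0]
    simp only [Int.cast_zero, ne_eq, OfNat.ofNat_ne_zero, not_false_eq_true, zero_pow, mul_zero,
      neg_zero, zero_mul, Real.exp_zero, mul_one, add_sub_cancel_left]
    rw [← tsum_mul_left]
    congr 1
    ext n
    split_ifs with h
    · simp
    · rw [mul_left_comm, ← Real.exp_add]
      congr 2
      ring
  rw [tendsto_congr' h1]
  have h2 : (2 * (-π) ^ k : ℝ) = ∑' n : ℤ, if n = 1 ∨ n = -1 then (-π) ^ k else 0 := by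
    rw [tsum_eq_sum (s := {1, -1})]
    · simp; ring
    · intro n hn
      simp at hn
      simp [hn]
  rw [h2]
  refine tendsto_tsum_of_dominated_convergence
    (bound := fun n : ℤ => Real.exp π * ((π * (n : ℝ) ^ 2) ^ k * Real.exp (-(π * (n : ℝ) ^ 2) * 1)))
    ((thk_summable_abs k one_pos).mul_left _) ?_ ?_
  · intro n
    by_cases h0 : n = 0
    · simp [h0]
    by_cases h : n = 1 ∨ n = -1
    · have : (n : ℝ) ^ 2 = 1 := by rcases h with h | h <;> simp [h]
      simp [h0, h, this]
    · simp only [h0, h, if_false]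
      have hn : (4 : ℤ) ≤ n ^ 2 := by
        push Not at h
        have : 2 ≤ |n| := by
          have : n ≤ -2 ∨ 2 ≤ n := by omega
          rcases this with h | h
          · rw [abs_of_neg (by omega)]; omega
          · rw [abs_of_pos (by omega)]; omega
        nlinarith [sq_abs n]
      have hn' : (4 : ℝ) ≤ (n : ℝ) ^ 2 := by exact_mod_cast hn
      have : Tendsto (fun y : ℝ => Real.exp (-(π * ((n : ℝ) ^ 2 - 1)) * y)) atTop (𝓝 0) := by
        apply Real.tendsto_exp_atBot.comp
        apply tendsto_id.const_mul_atTop_of_neg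
        have := Real.pi_pos
        nlinarith
      simpa using this.const_mul ((-(π * (n : ℝ) ^ 2)) ^ k)
  · filter_upwards [eventually_ge_atTop 1] with y hy n
    split_ifs with h0
    · simp; positivity
    rw [norm_mul, norm_pow, norm_neg, Real.norm_of_nonneg (by positivity),
      Real.norm_of_nonneg (Real.exp_pos _).le, mul_left_comm, ← Real.exp_add]
    have hn : (1 : ℤ) ≤ n ^ 2 := by have : 0 < n ^ 2 := by positivity
                                    omega
    have hn' : (1 : ℝ) ≤ (n : ℝ) ^ 2 := by exact_mod_cast hn
    have := Real.pi_pos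
    gcongr
    nlinarith [mul_nonneg (mul_nonneg this.le (sub_nonneg.2 hn')) (sub_nonneg.2 hy)]

/-- rapid decay -/
def RD (f : ℝ → ℝ) : Prop := ∀ N : ℕ, Tendsto (fun y => y ^ N * f y) atTop (𝓝 0)

lemma RD_of_exp {f : ℝ → ℝ} {c l : ℝ} (hc : 0 < c)
    (h : Tendsto (fun y => Real.exp (c * y) * f y) atTop (𝓝 l)) : RD f := by
  intro N
  have h1 : Tendsto (fun y : ℝ => y ^ N * Real.exp (-c * y)) atTop (𝓝 0) := by
    have := (Real.tendsto_pow_mul_exp_neg_atTop_nhds_zero N).comp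
      (tendsto_id.const_mul_atTop hc)
    have := this.const_mul (1 / c ^ N)
    simp only [Function.comp_def, id, mul_zero] at this
    refine this.congr fun y => ?_
    rw [mul_pow]; field_simp
  have := h1.mul h
  rw [zero_mul] at this
  refine this.congr fun y => ?_
  have : Real.exp (-c * y) * Real.exp (c * y) = 1 := by rw [← Real.exp_add]; simp
  linear_combination (y ^ N * f y) * this

lemma RD.add {f g : ℝ → ℝ} (hf : RD f) (hg : RD g) : RD (fun y => f y + g y) := by
  intro N
  simpa [mul_add] using (hf N).add (hg N)

lemma RD.const_mul {f : ℝ → ℝ} (hf : RD f) (c : ℝ) : RD (fun y => c * f y) := by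
  intro N
  have := (hf N).const_mul c
  simp only [mul_zero] at this
  exact this.congr fun y => by ring

lemma RD.sub {f g : ℝ → ℝ} (hf : RD f) (hg : RD g) : RD (fun y => f y - g y) := by
  have := hf.add (hg.const_mul (-1))
  simpa [sub_eq_add_neg] using this

lemma RD.mul_tendsto {f g : ℝ → ℝ} {l : ℝ} (hf : RD f) (hg : Tendsto g atTop (𝓝 l)) :
    RD (fun y => f y * g y) := by
  intro N
  have := (hf N).mul hg
  simpa [mul_assoc] using this

lemma RD.pow_mul {f : ℝ → ℝ} (hf : RD f) (M : ℕ) : RD (fun y => y ^ M * f y) := by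
  intro N
  refine (hf (N + M)).congr fun y => by ring

lemma RD.tendsto {f : ℝ → ℝ} (hf : RD f) : Tendsto f atTop (𝓝 0) := by
  simpa using hf 0

lemma RD.comp_mul {f : ℝ → ℝ} (hf : RD f) {c : ℝ} (hc : 0 < c) : RD (fun y => f (c * y)) := by
  intro N
  have := ((hf N).comp (tendsto_id.const_mul_atTop hc)).const_mul (1 / c ^ N)
  simp only [Function.comp_def, id, mul_zero] at this
  refine this.congr fun y => ?_
  rw [mul_pow]; field_simp

lemma thk_RD (k : ℕ) : RD (fun y => thk k y - 0 ^ k) := RD_of_exp Real.pi_pos (thk_tendsto k)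

open Real MeasureTheory intervalIntegral Complex
open Filter Topology Set

noncomputable def T3 (y : ℝ) : ℝ := thk 0 y
noncomputable def T2 (y : ℝ) : ℝ := thk 0 (y / 4) - thk 0 y
noncomputable def T4 (y : ℝ) : ℝ := 2 * thk 0 (4 * y) - thk 0 y
noncomputable def D3 (y : ℝ) : ℝ := thk 1 y
noncomputable def D2 (y : ℝ) : ℝ := thk 1 (y / 4) / 4 - thk 1 y
noncomputable def D4 (y : ℝ) : ℝ := 8 * thk 1 (4 * y) - thk 1 y
noncomputable def DD3 (y : ℝ) : ℝ := thk 2 y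
noncomputable def DD2 (y : ℝ) : ℝ := thk 2 (y / 4) / 16 - thk 2 y
noncomputable def DD4 (y : ℝ) : ℝ := 32 * thk 2 (4 * y) - thk 2 y

lemma thk_quarter (k : ℕ) {y : ℝ} (hy : 0 < y) :
    HasDerivAt (fun y => thk k (y / 4)) (thk (k + 1) (y / 4) / 4) y := by
  have := (thk_hasDerivAt k (y := y / 4) (by positivity)).comp y ((hasDerivAt_id y).div_const 4)
  simpa [Function.comp_def, div_eq_mul_inv] using this

lemma thk_four (k : ℕ) {y : ℝ} (hy : 0 < y) :
    HasDerivAt (fun y => thk k (4 * y)) (4 * thk (k + 1) (4 * y)) y := by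
  have := (thk_hasDerivAt k (y := 4 * y) (by positivity)).comp y ((hasDerivAt_id y).const_mul 4)
  simpa [Function.comp_def, mul_comm] using this

lemma T3_d {y : ℝ} (hy : 0 < y) : HasDerivAt T3 (D3 y) y := thk_hasDerivAt 0 hy
lemma D3_d {y : ℝ} (hy : 0 < y) : HasDerivAt D3 (DD3 y) y := thk_hasDerivAt 1 hy
lemma T2_d {y : ℝ} (hy : 0 < y) : HasDerivAt T2 (D2 y) y :=
  (thk_quarter 0 hy).sub (thk_hasDerivAt 0 hy)
lemma D2_d {y : ℝ} (hy : 0 < y) : HasDerivAt D2 (DD2 y) y := by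
  have := ((thk_quarter 1 hy).div_const 4).sub (thk_hasDerivAt 1 hy)
  convert! this using 1
  rw [DD2]; ring
lemma T4_d {y : ℝ} (hy : 0 < y) : HasDerivAt T4 (D4 y) y := by
  have := ((thk_four 0 hy).const_mul 2).sub (thk_hasDerivAt 0 hy)
  convert! this using 1
  rw [D4]; ring
lemma D4_d {y : ℝ} (hy : 0 < y) : HasDerivAt D4 (DD4 y) y := by
  have := ((thk_four 1 hy).const_mul 8).sub (thk_hasDerivAt 1 hy)
  convert! this using 1
  rw [DD4]; ring

lemma hasSum_split {ι α β : Type*} {f : ι → ℝ} {e1 : α → ι} {e2 : β → ι} {a b : ℝ}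
    (h1 : Function.Injective e1) (h2 : Function.Injective e2) (hc : IsCompl (range e1) (range e2))
    (ha : HasSum (f ∘ e1) a) (hb : HasSum (f ∘ e2) b) : HasSum f (a + b) :=
  (h1.hasSum_range_iff.2 ha).add_isCompl hc (h2.hasSum_range_iff.2 hb)

lemma tsum_split {ι α β : Type*} {f : ι → ℝ} {e1 : α → ι} {e2 : β → ι}
    (h1 : Function.Injective e1) (h2 : Function.Injective e2) (hc : IsCompl (range e1) (range e2))
    (hf : Summable f) : ∑' i, f i = ∑' i, f (e1 i) + ∑' i, f (e2 i) :=
  (hasSum_split h1 h2 hc (hf.comp_injective h1).hasSum (hf.comp_injective h2).hasSum).tsum_eq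

lemma T3_summable {y : ℝ} (hy : 0 < y) :
    Summable fun n : ℤ => Real.exp (-(π * (n : ℝ) ^ 2) * y) := by
  simpa using thk_summable 0 hy

lemma T3_eq (y : ℝ) : T3 y = ∑' n : ℤ, Real.exp (-(π * (n : ℝ) ^ 2) * y) := by
  simp [T3, thk]

lemma inj_even : Function.Injective (fun a : ℤ => 2 * a) := fun a b h => by simpa using h
lemma inj_odd : Function.Injective (fun a : ℤ => 2 * a + 1) := fun a b h => by simpa using h
lemma compl_even_odd : IsCompl (range fun a : ℤ => 2 * a) (range fun a : ℤ => 2 * a + 1) := by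
  constructor
  · rw [Set.disjoint_iff]
    rintro x ⟨⟨a, ha⟩, ⟨b, hb⟩⟩
    simp only at ha hb
    omega
  · rw [codisjoint_iff_le_sup]
    intro x _
    rcases Int.even_or_odd' x with ⟨c, h | h⟩
    · exact Or.inl ⟨c, h.symm⟩
    · exact Or.inr ⟨c, h.symm⟩

lemma T2_summable {y : ℝ} (hy : 0 < y) :
    Summable fun n : ℤ => Real.exp (-(π * ((n : ℝ) + 1 / 2) ^ 2) * y) := by
  have := (T3_summable (y := y / 4) (by positivity)).comp_injective inj_odd
  refine this.congr fun n => ?_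
  simp only [Function.comp_def]
  congr 1
  push_cast
  ring

lemma T2_eq {y : ℝ} (hy : 0 < y) :
    T2 y = ∑' n : ℤ, Real.exp (-(π * ((n : ℝ) + 1 / 2) ^ 2) * y) := by
  have := tsum_split inj_even inj_odd compl_even_odd (T3_summable (y := y / 4) (by positivity))
  have h1 : T3 (y / 4) = T3 y + ∑' n : ℤ, Real.exp (-(π * ((n : ℝ) + 1 / 2) ^ 2) * y) := by
    rw [T3_eq, T3_eq, this]
    congr 1 <;> congr 1 <;> ext n <;> congr 1 <;> push_cast <;> ring
  rw [T2]
  rw [T3, T3] at h1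
  linarith

lemma T2_pos {y : ℝ} (hy : 0 < y) : 0 < T2 y := by
  rw [T2_eq hy]
  exact (T2_summable hy).tsum_pos (fun n => (Real.exp_pos _).le) 0 (Real.exp_pos _)

lemma T3_pos {y : ℝ} (hy : 0 < y) : 0 < T3 y := by
  rw [T3_eq]
  exact (T3_summable hy).tsum_pos (fun n => (Real.exp_pos _).le) 0 (Real.exp_pos _)

lemma T3_S {y : ℝ} (hy : 0 < y) : T3 (1 / y) = √y * T3 y := by
  have h := Real.tsum_exp_neg_mul_int_sq (a := 1 / y) (by positivity)
  rw [T3_eq, T3_eq]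
  have e1 : (∑' n : ℤ, Real.exp (-(π * (n : ℝ) ^ 2) * (1 / y))) =
      ∑' n : ℤ, Real.exp (-π * (1 / y) * (n : ℝ) ^ 2) := by
    congr 1; ext n; congr 1; ring
  have e2 : (∑' n : ℤ, Real.exp (-(π * (n : ℝ) ^ 2) * y)) =
      ∑' n : ℤ, Real.exp (-π / (1 / y) * (n : ℝ) ^ 2) := by
    congr 1; ext n; congr 1; field_simp
  rw [e1, e2, h]
  congr 1
  rw [← Real.sqrt_eq_rpow, Real.sqrt_div zero_le_one]
  simp

lemma sqrt_four : √(4 : ℝ) = 2 := by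
  rw [show (4 : ℝ) = 2 ^ 2 by norm_num]; exact Real.sqrt_sq (by norm_num)

lemma T2_S {y : ℝ} (hy : 0 < y) : T2 (1 / y) = √y * T4 y := by
  have h1 := T3_S hy
  have h2 := T3_S (y := 4 * y) (by positivity)
  rw [Real.sqrt_mul (by norm_num), sqrt_four] at h2
  simp only [T2, T4, T3] at *
  rw [show 1 / y / 4 = 1 / (4 * y) by field_simp, h1, h2]
  ring

lemma T4_S {y : ℝ} (hy : 0 < y) : T4 (1 / y) = √y * T2 y := by
  have h := T2_S (y := 1 / y) (by positivity)
  rw [one_div_one_div, Real.sqrt_div zero_le_one, Real.sqrt_one] at h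
  have : √y ≠ 0 := by positivity
  rw [h]
  field_simp

lemma T4_pos {y : ℝ} (hy : 0 < y) : 0 < T4 y := by
  have h := T2_S hy
  have h2 := T2_pos (y := 1 / y) (by positivity)
  rw [h] at h2
  exact pos_of_mul_pos_right h2 (by positivity)

lemma latt {y : ℝ} (hy : 0 < y) : T3 y ^ 2 = T3 (2 * y) ^ 2 + T2 (2 * y) ^ 2 := by
  have h2y : 0 < 2 * y := by positivity
  have s3 := (T3_summable hy).norm
  have s3' := (T3_summable h2y).norm
  have s2' := (T2_summable h2y).norm
  rw [sq, sq, sq, T2_eq h2y, T3_eq, T3_eq, tsum_mul_tsum_of_summable_norm s3 s3,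
    tsum_mul_tsum_of_summable_norm s3' s3', tsum_mul_tsum_of_summable_norm s2' s2']
  rw [tsum_split (e1 := fun p : ℤ × ℤ => (p.1 + p.2, p.1 - p.2))
    (e2 := fun p : ℤ × ℤ => (p.1 + p.2 + 1, p.1 - p.2)) ?_ ?_ ?_
    (summable_mul_of_summable_norm s3 s3)]
  · congr 1 <;> congr 1 <;> ext p <;> rw [← Real.exp_add, ← Real.exp_add] <;> congr 1 <;>
      push_cast <;> ring
  · rintro ⟨a, b⟩ ⟨c, d⟩ h
    simp only [Prod.mk.injEq] at h ⊢
    omega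
  · rintro ⟨a, b⟩ ⟨c, d⟩ h
    simp only [Prod.mk.injEq] at h ⊢
    omega
  · constructor
    · rw [Set.disjoint_iff]
      rintro ⟨x, z⟩ ⟨⟨⟨a, b⟩, ha⟩, ⟨⟨c, d⟩, hb⟩⟩
      simp only [Prod.mk.injEq] at ha hb
      omega
    · rw [codisjoint_iff_le_sup]
      rintro ⟨x, z⟩ _
      rcases Int.even_or_odd' (x + z) with ⟨c, h | h⟩
      · refine Or.inl ⟨(c, x - c), ?_⟩
        simp only [Prod.mk.injEq]
        omega
      · refine Or.inr ⟨(c, x - c - 1), ?_⟩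
        simp only [Prod.mk.injEq]
        omega

lemma dbl3 {y : ℝ} (hy : 0 < y) : T3 y ^ 2 + T4 y ^ 2 = 2 * T3 (2 * y) ^ 2 := by
  have h := latt (y := 1 / (2 * y)) (by positivity)
  rw [show 2 * (1 / (2 * y)) = 1 / y by field_simp, T3_S hy, T2_S hy, T3_S (by positivity)] at h
  rw [mul_pow, mul_pow, mul_pow, Real.sq_sqrt (by positivity), Real.sq_sqrt hy.le] at h
  have : y * (T3 y ^ 2 + T4 y ^ 2 - 2 * T3 (2 * y) ^ 2) = 0 := by linarith
  rcases mul_eq_zero.1 this with h | h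
  · exact absurd h hy.ne'
  · linarith

lemma dbl2 {y : ℝ} (hy : 0 < y) : T3 y ^ 2 - T4 y ^ 2 = 2 * T2 (2 * y) ^ 2 := by
  linarith [latt hy, dbl3 hy]

lemma dbl4 {y : ℝ} (hy : 0 < y) : T3 y * T4 y = T4 (2 * y) ^ 2 := by
  have e3 : T3 y = T3 (4 * y) + T2 (4 * y) := by
    simp only [T3, T2]; rw [show 4 * y / 4 = y by ring]; ring
  have e4 : T4 y = T3 (4 * y) - T2 (4 * y) := by
    simp only [T3, T2, T4]; rw [show 4 * y / 4 = y by ring]; ring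
  have h1 := latt (y := 2 * y) (by positivity)
  have h2 := dbl3 (y := 2 * y) (by positivity)
  rw [show 2 * (2 * y) = 4 * y by ring] at h1 h2
  rw [e3, e4]
  linarith

lemma dbl23 {y : ℝ} (hy : 0 < y) : 2 * (T2 (2 * y) * T3 (2 * y)) = T2 y ^ 2 := by
  have h := dbl4 (y := 1 / (2 * y)) (by positivity)
  rw [show 2 * (1 / (2 * y)) = 1 / y by field_simp, T4_S hy, T4_S (by positivity),
    T3_S (by positivity), mul_pow, Real.sq_sqrt hy.le] at h
  have h2 : √(2 * y) * √(2 * y) = 2 * y := Real.mul_self_sqrt (by positivity)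
  have : y * (2 * (T2 (2 * y) * T3 (2 * y)) - T2 y ^ 2) = 0 := by
    linear_combination h - T3 (2 * y) * T2 (2 * y) * h2
  rcases mul_eq_zero.1 this with h | h
  · exact absurd h hy.ne'
  · linarith

lemma jac {y : ℝ} (hy : 0 < y) : T3 y ^ 4 = T2 y ^ 4 + T4 y ^ 4 := by
  have h1 := dbl2 hy
  have h2 := dbl3 hy
  have h3 := dbl23 hy
  have : T3 y ^ 4 - T4 y ^ 4 = (T3 y ^ 2 + T4 y ^ 2) * (T3 y ^ 2 - T4 y ^ 2) := by ring
  rw [h1, h2] at this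
  have h4 : T2 y ^ 4 = (2 * (T2 (2 * y) * T3 (2 * y))) ^ 2 := by rw [h3]; ring
  linear_combination this - h4

lemma T3_lim : Tendsto T3 atTop (𝓝 1) := by
  have := (thk_RD 0).tendsto.add_const 1
  have h : Tendsto (fun y => thk 0 y) atTop (𝓝 1) := by simpa using this
  exact h

lemma T4_lim : Tendsto T4 atTop (𝓝 1) := by
  have h : Tendsto (fun y : ℝ => 4 * y) atTop atTop := tendsto_id.const_mul_atTop (by norm_num)
  have := ((T3_lim.comp h).const_mul 2).sub T3_lim
  norm_num [Function.comp_def] at this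
  exact this

lemma T2_exp : Tendsto (fun y => Real.exp (π / 4 * y) * T2 y) atTop (𝓝 2) := by
  have h4 : Tendsto (fun y : ℝ => 1 / 4 * y) atTop atTop :=
    tendsto_id.const_mul_atTop (by norm_num)
  have h1 := (thk_tendsto 0).comp h4
  have h2 := thk_tendsto 0
  have h3 : Tendsto (fun y : ℝ => Real.exp (-(3 * π / 4) * y)) atTop (𝓝 0) := by
    apply Real.tendsto_exp_atBot.comp
    apply tendsto_id.const_mul_atTop_of_neg
    have := Real.pi_pos
    linarith
  have := h1.sub (h3.mul h2)
  simp only [Function.comp_def, pow_zero, mul_one, zero_mul, sub_zero] at this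
  refine this.congr fun y => ?_
  rw [← mul_assoc (Real.exp (-(3*π/4)*y)), ← Real.exp_add, T2, show 1 / 4 * y = y / 4 by ring,
    show -(3 * π / 4) * y + π * y = π / 4 * y by ring, show π * (y / 4) = π / 4 * y by ring]
  ring

lemma T2_RD : RD T2 := RD_of_exp (by positivity) T2_exp
lemma D3_RD : RD D3 := by
  have h : RD (fun y => thk 1 y) := by simpa using thk_RD 1
  exact h
lemma DD3_RD : RD DD3 := by
  have h : RD (fun y => thk 2 y) := by simpa using thk_RD 2
  exact h
lemma D4_RD : RD D4 := ((D3_RD.comp_mul four_pos).const_mul 8).sub D3_RD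
lemma DD4_RD : RD DD4 := ((DD3_RD.comp_mul four_pos).const_mul 32).sub DD3_RD
lemma D2_RD : RD D2 := by
  have := ((D3_RD.comp_mul (c := 1 / 4) (by norm_num)).const_mul (1 / 4)).sub D3_RD
  convert this using 2 with y
  rw [D2, D3, D3]; congr 1; rw [one_div_mul_eq_div, one_div_mul_eq_div]
lemma DD2_RD : RD DD2 := by
  have := ((DD3_RD.comp_mul (c := 1 / 4) (by norm_num)).const_mul (1 / 16)).sub DD3_RD
  convert this using 2 with y
  rw [DD2, DD3, DD3]; congr 1; rw [one_div_mul_eq_div, one_div_mul_eq_div]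
lemma D3_exp : Tendsto (fun y => Real.exp (π * y) * D3 y) atTop (𝓝 (-(2 * π))) := by
  have := thk_tendsto 1
  simpa [D3] using this
lemma D4_exp : Tendsto (fun y => Real.exp (π * y) * D4 y) atTop (𝓝 (2 * π)) := by
  have h4 : Tendsto (fun y : ℝ => 4 * y) atTop atTop := tendsto_id.const_mul_atTop (by norm_num)
  have h1 := D3_exp.comp h4
  have h3 : Tendsto (fun y : ℝ => Real.exp (-(3 * π) * y)) atTop (𝓝 0) := by
    apply Real.tendsto_exp_atBot.comp
    apply tendsto_id.const_mul_atTop_of_neg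
    have := Real.pi_pos
    linarith
  have := ((h3.mul h1).const_mul 8).sub D3_exp
  simp only [Function.comp_def, zero_mul, mul_zero, zero_sub, neg_neg] at this
  refine this.congr fun y => ?_
  rw [← mul_assoc (Real.exp _), ← Real.exp_add, D4, D3, D3,
    show -(3 * π) * y + π * (4 * y) = π * y by ring]
  ring

open Real MeasureTheory intervalIntegral Complex
open Filter Topology Set

lemma inv_dbl {f : ℝ → ℝ} {L : ℝ} (h : ∀ y, 0 < y → f (2 * y) = f y)
    (hf : Tendsto f atTop (𝓝 L)) {y : ℝ} (hy : 0 < y) : f y = L := by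
  have h1 : ∀ n : ℕ, f (2 ^ n * y) = f y := by
    intro n
    induction n with
    | zero => simp
    | succ n ih => rw [pow_succ', mul_assoc, h _ (by positivity), ih]
  have h2 : Tendsto (fun n : ℕ => (2 : ℝ) ^ n * y) atTop atTop :=
    (tendsto_pow_atTop_atTop_of_one_lt (by norm_num)).atTop_mul_const hy
  have h3 := hf.comp h2
  have h4 : (f ∘ fun n : ℕ => (2 : ℝ) ^ n * y) = fun _ => f y := funext fun n => h1 n
  rw [h4] at h3
  exact tendsto_nhds_unique tendsto_const_nhds h3

lemma deriv_eq_of_pos {f g : ℝ → ℝ} {f' g' y : ℝ} (hy : 0 < y) (h : ∀ x, 0 < x → f x = g x)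
    (hf : HasDerivAt f f' y) (hg : HasDerivAt g g' y) : f' = g' := by
  refine hf.unique (hg.congr_of_eventuallyEq ?_)
  filter_upwards [lt_mem_nhds hy] with x hx using h x hx

lemma comp_two {f : ℝ → ℝ} {f' y : ℝ} (hf : HasDerivAt f f' (2 * y)) :
    HasDerivAt (fun y => f (2 * y)) (2 * f') y := by
  have := hf.comp y ((hasDerivAt_id y).const_mul 2)
  simpa [Function.comp_def, mul_comm] using this

lemma dbl3_d {y : ℝ} (hy : 0 < y) :
    T3 y * D3 y + T4 y * D4 y = 4 * (T3 (2 * y) * D3 (2 * y)) := by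
  have h2 : 0 < 2 * y := by positivity
  have := deriv_eq_of_pos hy (fun x hx => dbl3 hx) (((T3_d hy).pow 2).add ((T4_d hy).pow 2))
    (((comp_two (T3_d h2)).pow 2).const_mul 2)
  push_cast at this
  linear_combination this / 2

lemma dbl4_d {y : ℝ} (hy : 0 < y) :
    D3 y * T4 y + T3 y * D4 y = 4 * (T4 (2 * y) * D4 (2 * y)) := by
  have h2 : 0 < 2 * y := by positivity
  have := deriv_eq_of_pos hy (fun x hx => dbl4 hx) ((T3_d hy).mul (T4_d hy))
    ((comp_two (T4_d h2)).pow 2)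
  push_cast at this
  linear_combination this

noncomputable def qA (y : ℝ) : ℝ := D2 y / T2 y
noncomputable def qB (y : ℝ) : ℝ := D4 y / T4 y
noncomputable def qC (y : ℝ) : ℝ := D3 y / T3 y
noncomputable def dA (y : ℝ) : ℝ := DD2 y / T2 y - qA y ^ 2
noncomputable def dB (y : ℝ) : ℝ := DD4 y / T4 y - qB y ^ 2
noncomputable def dC (y : ℝ) : ℝ := DD3 y / T3 y - qC y ^ 2

lemma qA_d {y : ℝ} (hy : 0 < y) : HasDerivAt qA (dA y) y := by
  have h := T2_pos hy
  convert! (D2_d hy).div (T2_d hy) h.ne' using 1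
  rw [dA, qA]; field_simp
lemma qB_d {y : ℝ} (hy : 0 < y) : HasDerivAt qB (dB y) y := by
  have h := T4_pos hy
  convert! (D4_d hy).div (T4_d hy) h.ne' using 1
  rw [dB, qB]; field_simp
lemma qC_d {y : ℝ} (hy : 0 < y) : HasDerivAt qC (dC y) y := by
  have h := T3_pos hy
  convert! (D3_d hy).div (T3_d hy) h.ne' using 1
  rw [dC, qC]; field_simp

lemma D2_q {y : ℝ} (hy : 0 < y) : D2 y = qA y * T2 y := by
  rw [qA, div_mul_cancel₀ _ (T2_pos hy).ne']
lemma D4_q {y : ℝ} (hy : 0 < y) : D4 y = qB y * T4 y := by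
  rw [qB, div_mul_cancel₀ _ (T4_pos hy).ne']
lemma D3_q {y : ℝ} (hy : 0 < y) : D3 y = qC y * T3 y := by
  rw [qC, div_mul_cancel₀ _ (T3_pos hy).ne']

lemma BC_dbl {y : ℝ} (hy : 0 < y) :
    4 * T3 (2 * y) ^ 2 * (qB (2 * y) - qC (2 * y)) = (qB y - qC y) * T2 (2 * y) ^ 2 := by
  have h2 : 0 < 2 * y := by positivity
  have a1 := dbl3_d hy
  have a2 := dbl4_d hy
  rw [D3_q hy, D4_q hy, D3_q h2] at a1
  rw [D3_q hy, D4_q hy, D4_q h2] at a2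
  have b1 := dbl3 hy
  have b2 := dbl2 hy
  have b3 := dbl4 hy
  have hT4 := (T4_pos h2).ne'
  have e : 4 * qB (2 * y) = qC y + qB y := by
    have : T4 (2 * y) ^ 2 ≠ 0 := by positivity
    apply mul_right_cancel₀ this
    linear_combination -a2 + (qC y + qB y) * b3
  linear_combination T3 (2*y)^2 * e + a1 - (qC y + qB y) / 2 * b1 + (qB y - qC y) / 2 * b2

lemma BC {y : ℝ} (hy : 0 < y) : qB y - qC y = π / 4 * T2 y ^ 4 := by
  have key := inv_dbl (f := fun y => (qB y - qC y) / T2 y ^ 4) (L := π / 4) ?_ ?_ hy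
  · have := (T2_pos hy).ne'
    rw [div_eq_iff (by positivity)] at key
    exact key
  · intro y hy
    have h2 : 0 < 2 * y := by positivity
    have a := BC_dbl hy
    have b := dbl23 hy
    have c1 := T2_pos hy
    have c2 := T2_pos h2
    have c3 := T3_pos h2
    rw [div_eq_div_iff (by positivity) (by positivity), show T2 y ^ 4 = (T2 y ^ 2) ^ 2 by ring, ← b]
    linear_combination T2 (2 * y) ^ 2 * a
  · have h1 : Tendsto (fun y => Real.exp (π * y) * (D4 y / T4 y) - Real.exp (π * y) * (D3 y / T3 y))
        atTop (𝓝 (2 * π / 1 - (-(2 * π)) / 1)) := by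
      refine Tendsto.sub ?_ ?_
      · refine (D4_exp.div T4_lim one_ne_zero).congr fun y => ?_
        simp only [Pi.div_apply]; ring
      · refine (D3_exp.div T3_lim one_ne_zero).congr fun y => ?_
        simp only [Pi.div_apply]; ring
    have h2 := h1.div (T2_exp.pow 4) (by norm_num)
    rw [show (2 * π / 1 - (-(2 * π)) / 1) / 2 ^ 4 = π / 4 by ring] at h2
    refine h2.congr' ?_
    filter_upwards [eventually_gt_atTop 0] with y hy
    have := T2_pos hy
    have e : Real.exp (π / 4 * y) ^ 4 = Real.exp (π * y) := by
      rw [← Real.exp_nat_mul]; congr 1; push_cast; ring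
    simp only [Pi.div_apply, qB, qC]
    rw [mul_pow, e]
    have := Real.exp_pos (π * y)
    field_simp

lemma inv_d {f : ℝ → ℝ} {f' y : ℝ} (hy : 0 < y) (hf : HasDerivAt f f' (1 / y)) :
    HasDerivAt (fun y => f (1 / y)) (-f' / y ^ 2) y := by
  have h : HasDerivAt (fun y : ℝ => 1 / y) (-(y ^ 2)⁻¹) y := by
    simpa using hasDerivAt_inv hy.ne'
  convert! hf.comp y h using 1
  ring

lemma sqrt_mul_d {f : ℝ → ℝ} {f' y : ℝ} (hy : 0 < y) (hf : HasDerivAt f f' y) :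
    HasDerivAt (fun y => √y * f y) (√y * (f y / (2 * y) + f')) y := by
  convert! (Real.hasDerivAt_sqrt hy.ne').mul hf using 1
  have h : √y ^ 2 = y := Real.sq_sqrt hy.le
  have : √y ≠ 0 := by positivity
  have h1 : √y / (2 * y) = 1 / (2 * √y) := by
    rw [div_eq_div_iff (by positivity) (by positivity)]; linear_combination 2 * h
  rw [mul_add, ← h1]; ring

lemma D2_S {y : ℝ} (hy : 0 < y) : D2 (1 / y) = - (y ^ 2 * (√y * (T4 y / (2 * y) + D4 y))) := by
  have := deriv_eq_of_pos hy (fun x hx => T2_S hx) (inv_d hy (T2_d (by positivity)))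
    (sqrt_mul_d hy (T4_d hy))
  rw [← this]; field_simp
lemma D4_S {y : ℝ} (hy : 0 < y) : D4 (1 / y) = - (y ^ 2 * (√y * (T2 y / (2 * y) + D2 y))) := by
  have := deriv_eq_of_pos hy (fun x hx => T4_S hx) (inv_d hy (T4_d (by positivity)))
    (sqrt_mul_d hy (T2_d hy))
  rw [← this]; field_simp
lemma D3_S {y : ℝ} (hy : 0 < y) : D3 (1 / y) = - (y ^ 2 * (√y * (T3 y / (2 * y) + D3 y))) := by
  have := deriv_eq_of_pos hy (fun x hx => T3_S hx) (inv_d hy (T3_d (by positivity)))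
    (sqrt_mul_d hy (T3_d hy))
  rw [← this]; field_simp

lemma qB_S {y : ℝ} (hy : 0 < y) : qB (1 / y) = - (y ^ 2 * (1 / (2 * y) + qA y)) := by
  have := T2_pos hy
  rw [qB, qA, D4_S hy, T4_S hy]
  field_simp
lemma qC_S {y : ℝ} (hy : 0 < y) : qC (1 / y) = - (y ^ 2 * (1 / (2 * y) + qC y)) := by
  have := T3_pos hy
  rw [qC, qC, D3_S hy, T3_S hy]
  field_simp

lemma AC {y : ℝ} (hy : 0 < y) : qA y - qC y = -(π / 4 * T4 y ^ 4) := by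
  have h := BC (y := 1 / y) (by positivity)
  rw [qB_S hy, qC_S hy, T2_S hy, mul_pow, show √y ^ 4 = (√y ^ 2) ^ 2 by ring,
    Real.sq_sqrt hy.le] at h
  have : y ^ 2 ≠ 0 := by positivity
  apply mul_left_cancel₀ this
  linear_combination -h

lemma AB {y : ℝ} (hy : 0 < y) : qA y - qB y = -(π / 4 * T3 y ^ 4) := by
  linear_combination AC hy - BC hy + π / 4 * jac hy

lemma BC_d {y : ℝ} (hy : 0 < y) : dB y - dC y = 4 * qA y * (qB y - qC y) := by
  have := deriv_eq_of_pos hy (fun x hx => BC hx) ((qB_d hy).sub (qC_d hy))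
    (((T2_d hy).pow 4).const_mul (π / 4))
  rw [this, BC hy, D2_q hy]; push_cast; ring
lemma AC_d {y : ℝ} (hy : 0 < y) : dA y - dC y = 4 * qB y * (qA y - qC y) := by
  have := deriv_eq_of_pos hy (fun x hx => AC hx) ((qA_d hy).sub (qC_d hy))
    (((T4_d hy).pow 4).const_mul (π / 4)).neg
  rw [this, AC hy, D4_q hy]; push_cast; ring
lemma AB_d {y : ℝ} (hy : 0 < y) : dA y - dB y = 4 * qC y * (qA y - qB y) := by
  have := deriv_eq_of_pos hy (fun x hx => AB hx) ((qA_d hy).sub (qB_d hy))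
    (((T3_d hy).pow 4).const_mul (π / 4)).neg
  rw [this, AB hy, D3_q hy]; push_cast; ring

lemma qA_dbl {y : ℝ} (hy : 0 < y) : qA y = qA (2 * y) + qC (2 * y) := by
  have h2 : 0 < 2 * y := by positivity
  have := deriv_eq_of_pos hy (fun x hx => dbl23 hx)
    (((comp_two (T2_d h2)).mul (comp_two (T3_d h2))).const_mul 2) ((T2_d hy).pow 2)
  push_cast at this
  rw [D2_q h2, D3_q h2, D2_q hy] at this
  have h3 : T2 y ^ 2 ≠ 0 := by have := T2_pos hy; positivity
  apply mul_right_cancel₀ h3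
  linear_combination -this / 2 - (qA (2*y) + qC (2*y)) * (-dbl23 hy)
lemma dA_dbl {y : ℝ} (hy : 0 < y) : dA y = 2 * (dA (2 * y) + dC (2 * y)) := by
  have h2 : 0 < 2 * y := by positivity
  have := deriv_eq_of_pos hy (fun x hx => qA_dbl hx) (qA_d hy)
    ((comp_two (qA_d h2)).add (comp_two (qC_d h2)))
  rw [this]; ring

lemma qB_RD : RD qB := by
  have h := T4_lim.inv₀ one_ne_zero
  exact (D4_RD.mul_tendsto h)
lemma qC_RD : RD qC := by
  have h := T3_lim.inv₀ one_ne_zero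
  exact (D3_RD.mul_tendsto h)
lemma dB_RD : RD dB := by
  have h := T4_lim.inv₀ one_ne_zero
  have := (DD4_RD.mul_tendsto h).sub (qB_RD.mul_tendsto qB_RD.tendsto)
  convert this using 2 with y
  rw [dB, sq]; rfl
lemma dC_RD : RD dC := by
  have h := T3_lim.inv₀ one_ne_zero
  have := (DD3_RD.mul_tendsto h).sub (qC_RD.mul_tendsto qC_RD.tendsto)
  convert this using 2 with y
  rw [dC, sq]; rfl

lemma halphen {y : ℝ} (hy : 0 < y) : dB y + dC y - 4 * qB y * qC y = 0 := by
  have key := inv_dbl (f := fun y => y ^ 2 * (dB y + dC y - 4 * (qB y * qC y))) (L := 0) ?_ ?_ hy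
  · have := hy.ne'
    simp only [mul_eq_zero, pow_eq_zero_iff, ne_eq, OfNat.ofNat_ne_zero, not_false_eq_true, this, false_or] at key
    linarith
  · intro y hy
    have h2 : 0 < 2 * y := by positivity
    have a1 := qA_dbl hy
    have a2 := dA_dbl hy
    have b1 := BC_d hy
    have b2 := AC_d hy
    have b3 := AB_d hy
    have c1 := BC_d h2
    have c3 := AB_d h2
    have d1 := AC h2
    have d2 := AC hy
    have d3 := AB hy
    have e : T4 (2 * y) ^ 4 = T3 y ^ 2 * T4 y ^ 2 := by
      rw [show T4 (2 * y) ^ 4 = (T4 (2 * y) ^ 2) ^ 2 by ring, ← dbl4 hy]; ring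
    have f1 : (qA (2*y) - qC (2*y)) ^ 2 = (qA y - qC y) * (qA y - qB y) := by
      rw [d1, d2, d3, e]; ring
    rw [mul_pow, show (2:ℝ)^2 * y^2 = y^2 * 4 by ring, mul_assoc]
    congr 1
    generalize qA y = A at *
    generalize qB y = B at *
    generalize qC y = C at *
    generalize dA y = A' at *
    generalize dB y = B' at *
    generalize dC y = C' at *
    have g1 : dB (2*y) + dC (2*y) - 4 * (qB (2*y) * qC (2*y)) =
      dA (2*y) + dC (2*y) - 4 * (qA (2*y) * qC (2*y)) := by linear_combination -c3
    rw [g1]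
    have g2 : 4 * (qA (2*y) * qC (2*y)) = A ^ 2 - (A - C) * (A - B) := by
      rw [← f1, a1]; ring
    rw [g2]
    linear_combination -2 * a2 + b2 + b3
  · have h := (dB_RD.add dC_RD).sub ((qB_RD.mul_tendsto qC_RD.tendsto).const_mul 4)
    exact h 2

lemma halphenAB {y : ℝ} (hy : 0 < y) : dA y + dB y = 4 * qA y * qB y := by
  linear_combination halphen hy + AC_d hy

lemma key_ode {y : ℝ} (hy : 0 < y) :
    DD2 y * T4 y - 6 * (D2 y * D4 y) + T2 y * DD4 y = π ^ 2 / 16 * (T3 y ^ 8 * T2 y * T4 y) := by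
  have a := T2_pos hy
  have b := T4_pos hy
  have h := halphenAB hy
  have hA : DD2 y = (dA y + qA y ^ 2) * T2 y := by
    rw [dA, sub_add_cancel, div_mul_cancel₀ _ a.ne']
  have hB : DD4 y = (dB y + qB y ^ 2) * T4 y := by
    rw [dB, sub_add_cancel, div_mul_cancel₀ _ b.ne']
  rw [hA, hB, D2_q hy, D4_q hy]
  have h3 := AB hy
  have h4 : (qA y - qB y) ^ 2 = π ^ 2 / 16 * T3 y ^ 8 := by rw [h3]; ring
  linear_combination T2 y * T4 y * (h + h4)

open Real MeasureTheory intervalIntegral Complex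
open Filter Topology Set

noncomputable def hJ (a b u : ℝ) : ℝ := (√((u ^ 2 + a ^ 2) * (u ^ 2 + b ^ 2)))⁻¹
noncomputable def JJ (a b : ℝ) : ℝ := ∫ u : ℝ, hJ a b u

lemma JJ_half (a b : ℝ) : JJ a b = 2 * ∫ u in Ioi (0:ℝ), hJ a b u := by
  rw [← integral_comp_abs, JJ]
  refine integral_congr_ae (Eventually.of_forall fun u => ?_)
  simp only [hJ, sq_abs]

lemma landen {a b : ℝ} (ha : 0 < a) (hb : 0 < b) : JJ ((a + b) / 2) √(a * b) = JJ a b := by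
  rw [JJ_half a b]
  have hab : 0 < a * b := by positivity
  have himg : (fun x : ℝ => (x - a * b / x) / 2) '' Ioi 0 = univ := by
    rw [eq_univ_iff_forall]
    intro u
    have hs : u ^ 2 < u ^ 2 + a * b := by linarith
    have h1 : |u| < √(u ^ 2 + a * b) := by
      rw [← Real.sqrt_sq_eq_abs]; exact Real.sqrt_lt_sqrt (sq_nonneg u) hs
    have h2 : 0 < u + √(u ^ 2 + a * b) := by linarith [neg_abs_le u]
    refine ⟨_, h2, ?_⟩
    have h3 : √(u ^ 2 + a * b) ^ 2 = u ^ 2 + a * b := Real.sq_sqrt (by positivity)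
    field_simp
    linear_combination h3
  have hinj : InjOn (fun x : ℝ => (x - a * b / x) / 2) (Ioi 0) := by
    apply StrictMonoOn.injOn
    intro x hx y hy hxy
    simp only [mem_Ioi] at hx hy
    have : a * b / y < a * b / x := div_lt_div_of_pos_left hab hx hxy
    simp only
    linarith
  rw [JJ, ← setIntegral_univ, ← himg, integral_image_eq_integral_abs_deriv_smul
    (f' := fun x => (1 + a * b / x ^ 2) / 2) measurableSet_Ioi ?_ hinj, ← MeasureTheory.integral_const_mul]
  · refine setIntegral_congr_fun measurableSet_Ioi fun x hx => ?_
    simp only [mem_Ioi] at hx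
    have e1 : ((x - a * b / x) / 2) ^ 2 + √(a * b) ^ 2 = ((x + a * b / x) / 2) ^ 2 := by
      rw [Real.sq_sqrt hab.le]; field_simp; ring
    have e2 : ((x - a * b / x) / 2) ^ 2 + ((a + b) / 2) ^ 2 =
        (x ^ 2 + a ^ 2) * (x ^ 2 + b ^ 2) / (2 * x) ^ 2 := by
      field_simp; ring
    simp only [hJ, smul_eq_mul]
    rw [e1, e2, Real.sqrt_mul (by positivity), Real.sqrt_sq (by positivity),
      Real.sqrt_div (by positivity), Real.sqrt_sq (by positivity), abs_of_pos (by positivity)]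
    have : 0 < √((x ^ 2 + a ^ 2) * (x ^ 2 + b ^ 2)) := by positivity
    field_simp
  · intro x hx
    simp only [mem_Ioi] at hx
    apply HasDerivAt.hasDerivWithinAt
    have := ((hasDerivAt_id x).sub ((hasDerivAt_inv hx.ne').const_mul (a * b))).div_const 2
    convert! this using 1
    field_simp; ring

lemma JJ_theta {y : ℝ} (hy : 0 < y) : JJ (T3 y ^ 2) (T4 y ^ 2) = π := by
  refine inv_dbl (f := fun y => JJ (T3 y ^ 2) (T4 y ^ 2)) (L := π) ?_ ?_ hy
  · intro y hy
    have a := T3_pos hy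
    have b := T4_pos hy
    rw [← landen (a := T3 y ^ 2) (b := T4 y ^ 2) (by positivity) (by positivity), dbl3 hy, ← mul_pow,
      Real.sqrt_sq (by positivity), dbl4 hy]
    congr 1; ring
  · have : π = ∫ u : ℝ, (1 + u ^ 2)⁻¹ := integral_univ_inv_one_add_sq.symm
    rw [this]
    refine tendsto_integral_filter_of_dominated_convergence (fun u => 4 * (1 + u ^ 2)⁻¹) ?_ ?_ ?_ ?_
    · refine Eventually.of_forall fun y => ?_
      unfold hJ
      apply Measurable.aestronglyMeasurable
      fun_prop
    · have h3 := T3_lim.pow 2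
      have h4 := T4_lim.pow 2
      rw [one_pow] at h3 h4
      filter_upwards [h3.eventually (lt_mem_nhds (show (1/2:ℝ) < 1 by norm_num)),
        h4.eventually (lt_mem_nhds (show (1/2:ℝ) < 1 by norm_num))] with y h3 h4
      refine Eventually.of_forall fun u => ?_
      rw [hJ, norm_of_nonneg (by positivity), ← div_eq_mul_inv, inv_eq_one_div,
        div_le_div_iff₀ (by positivity) (by positivity)]
      have : (1 + u ^ 2) / 4 ≤ √((u ^ 2 + (T3 y ^ 2) ^ 2) * (u ^ 2 + (T4 y ^ 2) ^ 2)) := by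
        apply Real.le_sqrt_of_sq_le
        rw [sq]
        apply mul_le_mul <;> nlinarith [sq_nonneg u]
      linarith
    · exact (integrable_inv_one_add_sq).const_mul 4
    · refine Eventually.of_forall fun u => ?_
      have h3 := ((T3_lim.pow 2).pow 2).const_add (u ^ 2)
      have h4 := ((T4_lim.pow 2).pow 2).const_add (u ^ 2)
      have := ((h3.mul h4).sqrt).inv₀ (by positivity)
      rw [← sq, Real.sqrt_sq (by positivity), one_pow, one_pow, add_comm] at this
      exact this

lemma JJ_scale {a b : ℝ} (ha : 0 < a) : JJ 1 (b / a) = a * JJ a b := by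
  have h := Measure.integral_comp_mul_left (fun u => hJ a b u) a
  rw [JJ, JJ]
  rw [abs_of_pos (by positivity), smul_eq_mul] at h
  have : (∫ x : ℝ, hJ a b (a * x)) = (a ^ 2)⁻¹ * ∫ x, hJ 1 (b / a) x := by
    rw [← MeasureTheory.integral_const_mul]
    refine integral_congr_ae (Eventually.of_forall fun u => ?_)
    simp only [hJ]
    rw [show ((a * u) ^ 2 + a ^ 2) * ((a * u) ^ 2 + b ^ 2) =
      (a ^ 2) ^ 2 * ((u ^ 2 + 1 ^ 2) * (u ^ 2 + (b / a) ^ 2)) by field_simp,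
      Real.sqrt_mul (by positivity), Real.sqrt_sq (by positivity), mul_inv]
  rw [this] at h
  field_simp at h ⊢
  linear_combination h

lemma ellK_JJ {t : ℝ} (h0 : 0 ≤ t) (h1 : t < 1) : ellipticK √t = JJ 1 √(1 - t) / 2 := by
  have hk : 0 < √(1 - t) := Real.sqrt_pos.2 (by linarith)
  have hk2 : √(1 - t) ^ 2 = 1 - t := Real.sq_sqrt (by linarith)
  set k := √(1 - t)
  have hp := Real.pi_pos
  have himg : (fun θ : ℝ => k * Real.tan θ) '' Ioo 0 (π / 2) = Ioi 0 := by
    ext u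
    simp only [mem_image, mem_Ioo, mem_Ioi]
    constructor
    · rintro ⟨θ, ⟨h, h'⟩, rfl⟩
      exact mul_pos hk (Real.tan_pos_of_pos_of_lt_pi_div_two h h')
    · intro hu
      refine ⟨Real.arctan (u / k), ⟨Real.arctan_pos.2 (by positivity), Real.arctan_lt_pi_div_two _⟩, ?_⟩
      rw [Real.tan_arctan]; field_simp
  have hinj : InjOn (fun θ : ℝ => k * Real.tan θ) (Ioo 0 (π / 2)) := by
    intro x hx y hy hxy
    simp only [mem_Ioo] at hx hy
    have := mul_left_cancel₀ hk.ne' hxy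
    exact Real.tan_inj_of_lt_of_lt_pi_div_two (by linarith) hx.2 (by linarith) hy.2 this
  rw [JJ_half, ← himg, integral_image_eq_integral_abs_deriv_smul
    (f' := fun θ => k * (1 / Real.cos θ ^ 2)) measurableSet_Ioo ?_ hinj, ellipticK,
    intervalIntegral.integral_of_le (by positivity), integral_Ioc_eq_integral_Ioo]
  · rw [mul_div_cancel_left₀ _ two_ne_zero]
    refine setIntegral_congr_fun measurableSet_Ioo fun θ hθ => ?_
    simp only [mem_Ioo] at hθ
    have hc : 0 < Real.cos θ := Real.cos_pos_of_mem_Ioo ⟨by linarith, hθ.2⟩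
    have hsc := Real.sin_sq_add_cos_sq θ
    have hpos : 0 < 1 - t * Real.sin θ ^ 2 := by nlinarith [sq_nonneg (Real.sin θ), sq_pos_of_pos hc]
    simp only [hJ, smul_eq_mul]
    rw [Real.sq_sqrt h0, Real.rpow_neg hpos.le, ← Real.sqrt_eq_rpow]
    have e : ((k * Real.tan θ) ^ 2 + 1 ^ 2) * ((k * Real.tan θ) ^ 2 + k ^ 2) =
        (k / Real.cos θ ^ 2) ^ 2 * (1 - t * Real.sin θ ^ 2) := by
      rw [Real.tan_eq_sin_div_cos]
      have e1 : (k * (Real.sin θ / Real.cos θ)) ^ 2 + 1 ^ 2 = (1 - t * Real.sin θ ^ 2) / Real.cos θ ^ 2 := by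
        field_simp
        linear_combination Real.sin θ ^ 2 * hk2 + hsc
      have e2 : (k * (Real.sin θ / Real.cos θ)) ^ 2 + k ^ 2 = (k / Real.cos θ) ^ 2 := by
        field_simp
        linear_combination hsc
      rw [e1, e2]; field_simp
    rw [e, Real.sqrt_mul (by positivity), Real.sqrt_sq (by positivity), abs_of_pos (by positivity)]
    have := Real.sqrt_pos.2 hpos
    field_simp
  · intro θ hθ
    simp only [mem_Ioo] at hθ
    have hc : 0 < Real.cos θ := Real.cos_pos_of_mem_Ioo ⟨by linarith, hθ.2⟩
    exact ((Real.hasDerivAt_tan hc.ne').const_mul k).hasDerivWithinAt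

noncomputable def tt (y : ℝ) : ℝ := T2 y ^ 4 / T3 y ^ 4

lemma tt_pos {y : ℝ} (hy : 0 < y) : 0 < tt y := by
  have := T2_pos hy
  have := T3_pos hy
  rw [tt]; positivity
lemma one_sub_tt {y : ℝ} (hy : 0 < y) : 1 - tt y = T4 y ^ 4 / T3 y ^ 4 := by
  have := T3_pos hy
  rw [tt]; field_simp; linear_combination jac hy
lemma tt_lt {y : ℝ} (hy : 0 < y) : tt y < 1 := by
  have h := one_sub_tt hy
  have := T4_pos hy
  have := T3_pos hy
  have : 0 < T4 y ^ 4 / T3 y ^ 4 := by positivity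
  linarith
lemma tt_inv {y : ℝ} (hy : 0 < y) : tt (1 / y) = 1 - tt y := by
  have := T3_pos hy
  rw [one_sub_tt hy, tt, T2_S hy, T3_S hy]; field_simp

lemma K_tt {y : ℝ} (hy : 0 < y) : ellipticK √(tt y) = π / 2 * T3 y ^ 2 := by
  have a := T3_pos hy
  have b := T4_pos hy
  rw [ellK_JJ (tt_pos hy).le (tt_lt hy), one_sub_tt hy,
    show T4 y ^ 4 / T3 y ^ 4 = (T4 y ^ 2 / T3 y ^ 2) ^ 2 by field_simp, Real.sqrt_sq (by positivity),
    JJ_scale (by positivity), JJ_theta hy]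
  ring
lemma K_tt' {y : ℝ} (hy : 0 < y) : ellipticK √(1 - tt y) = π / 2 * (y * T3 y ^ 2) := by
  rw [← tt_inv hy, K_tt (by positivity), T3_S hy, mul_pow, Real.sq_sqrt hy.le]

open Real MeasureTheory intervalIntegral Complex
open Filter Topology Set

lemma tendsto_zero_of_inv {f : ℝ → ℝ} {l : Filter ℝ} (h : Tendsto (fun w => f (1 / w)) atTop l) :
    Tendsto f (𝓝[>] 0) l := by
  have := h.comp tendsto_inv_nhdsGT_zero
  refine this.congr fun y => ?_
  simp

lemma intOn {f : ℝ → ℝ} (hc : ContinuousOn f (Ioi 0)) (hi : RD f)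
    (h0 : Tendsto (fun w => f (1 / w)) atTop (𝓝 0)) : IntegrableOn f (Ioi 0) := by
  have h := mellin_convergent_of_isBigO_scalar (f := f) (a := 2) (b := 0) (s := 1)
    (hc.locallyIntegrableOn measurableSet_Ioi) ?_ (by norm_num) ?_ (by norm_num)
  · simpa using h
  · have h2 := (hi 2).isBigO_one ℝ
    have h3 := h2.mul (Asymptotics.isBigO_refl (fun x : ℝ => x ^ (-2 : ℝ)) atTop)
    refine (h3.congr' ?_ ?_)
    · filter_upwards [eventually_gt_atTop 0] with x hx
      rw [Real.rpow_neg hx.le]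
      norm_cast
      field_simp
    · filter_upwards with x using by simp
  · have := (tendsto_zero_of_inv h0).isBigO_one ℝ
    simpa using this

lemma ftc0 {f f' : ℝ → ℝ} {a m : ℝ} (hd : ∀ x ∈ Ioi (0:ℝ), HasDerivAt f (f' x) x)
    (hint : IntegrableOn f' (Ioi 0)) (h0 : Tendsto f (𝓝[>] 0) (𝓝 a))
    (hi : Tendsto f atTop (𝓝 m)) : ∫ x in Ioi (0:ℝ), f' x = m - a := by
  have h := integral_Ioi_of_hasDerivAt_of_tendsto (f := Function.update f 0 a) (f' := f') (a := 0)
    (m := m) ?_ ?_ hint ?_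
  · simpa using h
  · rw [continuousWithinAt_update_same, Ici_sdiff_left]; exact h0
  · intro x hx
    refine (hd x hx).congr_of_eventuallyEq ?_
    filter_upwards [lt_mem_nhds hx] with y hy
    exact Function.update_of_ne (ne_of_gt hy) _ _
  · refine hi.congr' ?_
    filter_upwards [eventually_gt_atTop 0] with y hy
    exact (Function.update_of_ne (ne_of_gt hy) _ _).symm

lemma T2_c : ContinuousOn T2 (Ioi 0) := fun _ hx => (T2_d hx).continuousAt.continuousWithinAt
lemma T3_c : ContinuousOn T3 (Ioi 0) := fun _ hx => (T3_d hx).continuousAt.continuousWithinAt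
lemma T4_c : ContinuousOn T4 (Ioi 0) := fun _ hx => (T4_d hx).continuousAt.continuousWithinAt
lemma D2_c : ContinuousOn D2 (Ioi 0) := fun _ hx => (D2_d hx).continuousAt.continuousWithinAt
lemma D4_c : ContinuousOn D4 (Ioi 0) := fun _ hx => (D4_d hx).continuousAt.continuousWithinAt

lemma f1_int : IntegrableOn (fun y => y * (T3 y ^ 8 * T2 y * T4 y)) (Ioi 0) := by
  have h1 : RD (fun y => T2 y * (T3 y ^ 8 * T4 y)) :=
    T2_RD.mul_tendsto ((T3_lim.pow 8).mul T4_lim)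
  apply intOn
  · exact continuousOn_id.mul (((T3_c.pow 8).mul T2_c).mul T4_c)
  · convert h1.pow_mul 1 using 2 with y
    ring
  · refine (h1 4).congr' ?_
    filter_upwards [eventually_gt_atTop 0] with w hw
    have e : √w ^ 2 = w := Real.sq_sqrt hw.le
    rw [T3_S hw, T2_S hw, T4_S hw,
      show 1 / w * ((√w * T3 w) ^ 8 * (√w * T4 w) * (√w * T2 w)) =
        1 / w * ((√w ^ 2) ^ 5 * T3 w ^ 8 * T4 w * T2 w) by ring, e]
    field_simp

lemma f2_int : IntegrableOn (fun y => y * (D2 y * D4 y)) (Ioi 0) := by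
  apply intOn
  · exact continuousOn_id.mul (D2_c.mul D4_c)
  · convert (D2_RD.mul_tendsto D4_RD.tendsto).pow_mul 1 using 2 with y
    ring
  · have h1 : RD (fun w => (1/2 * T2 w + w ^ 1 * D2 w) * (1/2 * T4 w + w ^ 1 * D4 w)) :=
      ((T2_RD.const_mul (1/2)).add (D2_RD.pow_mul 1)).mul_tendsto
        ((T4_lim.const_mul (1/2)).add (D4_RD 1))
    refine (h1 2).congr' ?_
    filter_upwards [eventually_gt_atTop 0] with w hw
    have e : √w ^ 2 = w := Real.sq_sqrt hw.le
    rw [D2_S hw, D4_S hw]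
    rw [show 1 / w * (-(w ^ 2 * (√w * (T4 w / (2 * w) + D4 w))) * -(w ^ 2 * (√w * (T2 w / (2 * w) + D2 w))))
      = 1 / w * ((w ^ 2) ^ 2 * (√w ^ 2) * ((T4 w / (2 * w) + D4 w)) * (T2 w / (2 * w) + D2 w)) by ring, e]
    field_simp

lemma S_part : ∫ y in Ioi (0:ℝ), y * (T3 y ^ 8 * T2 y * T4 y) =
    -(8 * 16 / π ^ 2) * ∫ y in Ioi (0:ℝ), y * (D2 y * D4 y) := by
  have hp := Real.pi_pos
  have h := ftc0 (f := fun y => y * (D2 y * T4 y + T2 y * D4 y) - T2 y * T4 y)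
    (f' := fun y => π ^ 2 / 16 * (y * (T3 y ^ 8 * T2 y * T4 y)) + 8 * (y * (D2 y * D4 y)))
    (a := 0) (m := 0) ?_ (Integrable.fun_add (f1_int.const_mul (π ^ 2 / 16)) (f2_int.const_mul 8)) ?_ ?_
  · rw [integral_add (f1_int.const_mul _) (f2_int.const_mul _), MeasureTheory.integral_const_mul,
      MeasureTheory.integral_const_mul] at h
    field_simp at h ⊢
    linear_combination h
  · intro y hy
    have := ((hasDerivAt_id y).mul (((D2_d hy).mul (T4_d hy)).add ((T2_d hy).mul (D4_d hy)))).sub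
      ((T2_d hy).mul (T4_d hy))
    convert! this using 1
    simp only [id, Pi.add_apply, Pi.mul_apply]
    linear_combination -y * key_ode hy
  · apply tendsto_zero_of_inv
    have h1 := ((T2_RD.mul_tendsto T4_lim) 1).const_mul (-2)
    have h2 := ((D2_RD.mul_tendsto T4_lim).add (T2_RD.mul_tendsto D4_RD.tendsto)) 2
    have h3 := h1.sub h2
    simp only [mul_zero, sub_zero] at h3
    refine h3.congr' ?_
    filter_upwards [eventually_gt_atTop 0] with w hw
    have e : √w ^ 2 = w := Real.sq_sqrt hw.le
    rw [D2_S hw, D4_S hw, T2_S hw, T4_S hw]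
    rw [show 1 / w * (-(w ^ 2 * (√w * (T4 w / (2 * w) + D4 w))) * (√w * T2 w) +
            √w * T4 w * -(w ^ 2 * (√w * (T2 w / (2 * w) + D2 w)))) - √w * T4 w * (√w * T2 w)
      = 1 / w * (-(w ^ 2 * (√w ^ 2 * (T4 w / (2 * w) + D4 w))) * (T2 w) +
            √w ^ 2 * T4 w * -(w ^ 2 * ((T2 w / (2 * w) + D2 w)))) - √w ^ 2 * T4 w * (T2 w) by ring, e]
    field_simp
    ring
  · have h2 := ((D2_RD.mul_tendsto T4_lim).add (T2_RD.mul_tendsto D4_RD.tendsto)) 1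
    have h3 := h2.sub (T2_RD.mul_tendsto T4_lim).tendsto
    simpa using h3

lemma tt_d {y : ℝ} (hy : 0 < y) : HasDerivAt tt (-(π * T2 y ^ 4 * T4 y ^ 4 / T3 y ^ 4)) y := by
  have h3 := T3_pos hy
  convert! ((T2_d hy).pow 4).div ((T3_d hy).pow 4) (pow_pos h3 4).ne' using 1
  have h := AC hy
  simp only [Pi.pow_apply]
  rw [D2_q hy, D3_q hy]
  push_cast
  field_simp
  linear_combination -4 * T2 y ^ 4 * h

lemma tt_lim : Tendsto tt atTop (𝓝 0) := by
  have := (T2_RD.tendsto.pow 4).div (T3_lim.pow 4) (by norm_num)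
  norm_num at this
  exact this

lemma tt_inj : InjOn tt (Ioi 0) := by
  apply StrictAntiOn.injOn
  apply strictAntiOn_of_deriv_neg (convex_Ioi 0)
  · exact fun x hx => (tt_d hx).continuousAt.continuousWithinAt
  · intro x hx
    rw [interior_Ioi] at hx
    rw [(tt_d hx).deriv]
    have := T2_pos hx
    have := T3_pos hx
    have := T4_pos hx
    have := Real.pi_pos
    simp only [Left.neg_neg_iff]
    positivity

lemma exists_tt_lt {u : ℝ} (hu : 0 < u) : ∃ y, 0 < y ∧ tt y < u := by
  have h1 := tt_lim.eventually (gt_mem_nhds hu)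
  obtain ⟨y, h1, h2⟩ := (h1.and (eventually_gt_atTop 0)).exists
  exact ⟨y, h2, h1⟩

lemma tt_image : tt '' Ioi 0 = Ioo 0 1 := by
  ext u
  constructor
  · rintro ⟨y, hy, rfl⟩
    exact ⟨tt_pos hy, tt_lt hy⟩
  · rintro ⟨h0, h1⟩
    obtain ⟨a, ha, ha'⟩ := exists_tt_lt h0
    obtain ⟨b, hb, hb'⟩ := exists_tt_lt (u := 1 - u) (by linarith)
    have hb1 : 0 < 1 / b := by positivity
    have hb2 : u < tt (1 / b) := by rw [tt_inv hb]; linarith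
    exact isPreconnected_Ioi.intermediate_value (mem_Ioi.2 ha) (mem_Ioi.2 hb1)
      (fun x hx => (tt_d hx).continuousAt.continuousWithinAt) ⟨ha'.le, hb2.le⟩

lemma I_part : (∫ t in (0:ℝ)..1, ellipticK (Real.sqrt (1 - t)) * (ellipticK (Real.sqrt t)) ^ 2 /
        (2 * t ^ ((3:ℝ)/4) * (1 - t) ^ ((3:ℝ)/4))) =
    -(8 * π ^ 2) * ∫ y in Ioi (0:ℝ), y * (D2 y * D4 y) := by
  have hp := Real.pi_pos
  rw [intervalIntegral.integral_of_le zero_le_one, integral_Ioc_eq_integral_Ioo, ← tt_image,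
    integral_image_eq_integral_abs_deriv_smul measurableSet_Ioi
      (fun x hx => (tt_d hx).hasDerivWithinAt) tt_inj]
  have : (-(8 * π ^ 2) * ∫ y in Ioi (0:ℝ), y * (D2 y * D4 y)) =
    π ^ 4 / 16 * ∫ y in Ioi (0:ℝ), y * (T3 y ^ 8 * T2 y * T4 y) := by
    rw [S_part]; field_simp
  rw [this, ← MeasureTheory.integral_const_mul]
  refine setIntegral_congr_fun measurableSet_Ioi fun y hy => ?_
  simp only [mem_Ioi] at hy
  have h2 := T2_pos hy
  have h3 := T3_pos hy
  have h4 := T4_pos hy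
  simp only [smul_eq_mul]
  rw [K_tt hy, K_tt' hy, one_sub_tt hy, tt, abs_neg, abs_of_pos (by positivity)]
  have e : ∀ a b : ℝ, 0 < a → 0 < b → (a ^ 4 / b ^ 4) ^ ((3:ℝ)/4) = a ^ 3 / b ^ 3 := by
    intro a b ha hb
    rw [← div_pow, ← div_pow, ← Real.rpow_natCast, ← Real.rpow_natCast, ← Real.rpow_mul (by positivity)]
    norm_num
  rw [e _ _ h2 h3, e _ _ h4 h3]
  field_simp
  norm_num

open Real MeasureTheory intervalIntegral Complex
open Filter Topology Set

lemma beta_real : ∫ x in Ioo (0:ℝ) 1, x ^ (-(3:ℝ)/4) * (1 - x) ^ (-(1:ℝ)/2) =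
    Real.Gamma (1/4) * Real.Gamma (1/2) / Real.Gamma (3/4) := by
  have h := Complex.betaIntegral_eq_Gamma_mul_div ((1/4 : ℝ) : ℂ) ((1/2 : ℝ) : ℂ)
    (by norm_num) (by norm_num)
  rw [← Complex.ofReal_add, Complex.Gamma_ofReal, Complex.Gamma_ofReal, Complex.Gamma_ofReal,
    Complex.betaIntegral, intervalIntegral.integral_of_le zero_le_one,
    integral_Ioc_eq_integral_Ioo] at h
  have h2 : ((∫ x in Ioo (0:ℝ) 1, x ^ (-(3:ℝ)/4) * (1 - x) ^ (-(1:ℝ)/2) : ℝ) : ℂ) =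
      ∫ x in Ioo (0:ℝ) 1, (x:ℂ) ^ (((1/4 : ℝ) : ℂ) - 1) * (1 - (x:ℂ)) ^ (((1/2 : ℝ) : ℂ) - 1) := by
    rw [← integral_complex_ofReal]
    refine setIntegral_congr_fun measurableSet_Ioo fun x hx => ?_
    simp only [mem_Ioo] at hx
    rw [Complex.ofReal_mul, Complex.ofReal_cpow hx.1.le, Complex.ofReal_cpow (by linarith)]
    push_cast
    norm_num
  rw [← h2] at h
  norm_num at h ⊢
  exact_mod_cast h

lemma JJ_beta : JJ 1 √2 = Real.Gamma (1/4) * Real.Gamma (1/2) / Real.Gamma (3/4) / 2 := by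
  rw [← beta_real, JJ_half]
  have himg : (fun u : ℝ => ((u ^ 2 + 1) ^ 2)⁻¹) '' Ioi 0 = Ioo 0 1 := by
    ext s
    constructor
    · rintro ⟨u, hu, rfl⟩
      simp only [mem_Ioi] at hu
      refine ⟨by positivity, ?_⟩
      apply inv_lt_one_of_one_lt₀
      nlinarith [sq_pos_of_pos hu]
    · rintro ⟨h0, h1⟩
      have h2 : √s < 1 := by rw [Real.sqrt_lt' one_pos]; simpa using h1
      have h3 : 0 < √s := Real.sqrt_pos.2 h0
      have h4 : 1 < (√s)⁻¹ := (one_lt_inv₀ h3).2 h2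
      refine ⟨√((√s)⁻¹ - 1), Real.sqrt_pos.2 (by linarith), ?_⟩
      simp only
      rw [Real.sq_sqrt (by linarith), sub_add_cancel, inv_pow, inv_inv, Real.sq_sqrt h0.le]
  have hinj : InjOn (fun u : ℝ => ((u ^ 2 + 1) ^ 2)⁻¹) (Ioi 0) := by
    apply StrictAntiOn.injOn
    intro x hx y hy hxy
    simp only [mem_Ioi] at hx hy
    simp only
    gcongr
  rw [← himg, integral_image_eq_integral_abs_deriv_smul
    (f' := fun u => -(4 * u / (u ^ 2 + 1) ^ 3)) measurableSet_Ioi ?_ hinj]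
  · have : ∀ x ∈ Ioi (0:ℝ), |-(4 * x / (x ^ 2 + 1) ^ 3)| • (((x ^ 2 + 1) ^ 2)⁻¹ ^ (-(3:ℝ)/4) *
        (1 - ((x ^ 2 + 1) ^ 2)⁻¹) ^ (-(1:ℝ)/2)) = 4 * hJ 1 √2 x := by
      intro x hx
      simp only [mem_Ioi] at hx
      have hv : 0 < x ^ 2 + 1 := by positivity
      have hw : 0 < x ^ 2 + 2 := by positivity
      rw [abs_neg, abs_of_pos (by positivity), smul_eq_mul, hJ, Real.sq_sqrt (by norm_num), one_pow]
      have e1 : (((x ^ 2 + 1) ^ 2)⁻¹) ^ (-(3:ℝ)/4) = (x ^ 2 + 1) * √(x ^ 2 + 1) := by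
        rw [neg_div, Real.rpow_neg (by positivity), Real.inv_rpow (by positivity), inv_inv,
          ← Real.rpow_natCast, ← Real.rpow_mul hv.le]
        rw [show ((2:ℕ):ℝ) * (3/4) = 1 + 1/2 by norm_num, Real.rpow_add hv, Real.rpow_one,
          Real.sqrt_eq_rpow]
      have e2 : (1 - ((x ^ 2 + 1) ^ 2)⁻¹) ^ (-(1:ℝ)/2) = (x ^ 2 + 1) / (x * √(x ^ 2 + 2)) := by
        rw [show 1 - ((x ^ 2 + 1) ^ 2)⁻¹ = (x / (x ^ 2 + 1)) ^ 2 * (x ^ 2 + 2) by field_simp; ring,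
          neg_div, Real.rpow_neg (by positivity), ← Real.sqrt_eq_rpow, Real.sqrt_mul (by positivity),
          Real.sqrt_sq (by positivity)]
        field_simp
      rw [e1, e2, Real.sqrt_mul (by positivity)]
      have a := Real.sqrt_pos.2 hv
      have b := Real.sqrt_pos.2 hw
      have a2 : √(x ^ 2 + 1) ^ 2 = x ^ 2 + 1 := Real.sq_sqrt hv.le
      field_simp
      linear_combination a2
    rw [setIntegral_congr_fun measurableSet_Ioi this, MeasureTheory.integral_const_mul]
    ring
  · intro x hx
    simp only [mem_Ioi] at hx
    apply HasDerivAt.hasDerivWithinAt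
    have h1 : HasDerivAt (fun u : ℝ => (u ^ 2 + 1) ^ 2) (2 * (x ^ 2 + 1) * (2 * x)) x := by
      have := ((hasDerivAt_pow 2 x).add_const 1).pow 2
      convert! this using 1
      simp
    have := h1.inv (by positivity)
    convert! this using 1
    field_simp; ring

lemma T24_one : T2 1 = T4 1 := by
  have := T2_S one_pos
  simpa using this

lemma T3_one : T3 1 ^ 8 = Real.Gamma (1/4) ^ 8 / (16 * π ^ 6) := by
  have hp := Real.pi_pos
  have h3 := T3_pos one_pos
  have h4 := T4_pos one_pos
  have hj := jac one_pos
  rw [T24_one] at hj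
  have h0 := JJ_theta one_pos
  have hs : JJ (T4 1 ^ 2) (T3 1 ^ 2) = π := by
    rw [← h0, JJ, JJ]; unfold hJ; simp only [mul_comm]
  have hsc := JJ_scale (a := T4 1 ^ 2) (b := T3 1 ^ 2) (by positivity)
  have e : T3 1 ^ 2 / T4 1 ^ 2 = √2 := by
    symm
    rw [Real.sqrt_eq_iff_mul_self_eq (by norm_num) (by positivity)]
    field_simp; linarith
  rw [hs, e, JJ_beta, Real.Gamma_one_half_eq] at hsc
  have hr := Real.Gamma_mul_Gamma_one_sub (1/4)
  rw [show π * (1/4) = π / 4 by ring, Real.sin_pi_div_four, show (1:ℝ) - 1/4 = 3/4 by norm_num] at hr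
  have hg : 0 < Real.Gamma (3/4) := Real.Gamma_pos_of_pos (by norm_num)
  have hg' : 0 < Real.Gamma (1/4) := Real.Gamma_pos_of_pos (by norm_num)
  generalize Real.Gamma (1/4) = g at *
  generalize Real.Gamma (3/4) = g' at *
  have hπ : √π ^ 2 = π := Real.sq_sqrt hp.le
  have h2 : √2 ^ 2 = (2:ℝ) := Real.sq_sqrt (by norm_num)
  have e1 : T4 1 ^ 2 = g * √π / g' / 2 / π := by rw [hsc]; field_simp
  have e2 : g' = 2 * π / (√2 * g) := by
    field_simp at hr ⊢; linear_combination hr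
  have e3 : T3 1 ^ 8 = 4 * (T4 1 ^ 2) ^ 4 := by
    rw [show T3 1 ^ 8 = (T3 1 ^ 4) ^ 2 by ring, hj]; ring
  rw [e3, e1, e2]
  have f1 : √π ^ 4 = π ^ 2 := by rw [show √π ^ 4 = (√π ^ 2) ^ 2 by ring, hπ]
  have f2 : √2 ^ 4 = (4:ℝ) := by rw [show √2 ^ 4 = (√2 ^ 2) ^ 2 by ring, h2]; norm_num
  field_simp
  rw [f1, f2]; ring

open Real MeasureTheory intervalIntegral Complex
open Filter Topology Set

noncomputable def qP (Q : ℝ) (n : ℕ) : ℝ := ∏ i ∈ Finset.range n, (1 - Q ^ (i + 1))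
noncomputable def gQ (Q : ℝ) (m : ℤ) : ℝ := if 0 ≤ m then (qP Q m.toNat)⁻¹ else 0

lemma exp_zpow' (x : ℝ) (m : ℤ) : Real.exp x ^ m = Real.exp (m * x) := by
  rw [← Real.rpow_intCast, ← Real.exp_mul, mul_comm]

lemma qP_pos {Q : ℝ} (h0 : 0 < Q) (h1 : Q < 1) (n : ℕ) : 0 < qP Q n := by
  apply Finset.prod_pos
  intro i _
  have : Q ^ (i + 1) < 1 := pow_lt_one₀ h0.le h1 (by omega)
  linarith

lemma gQ_rec {Q : ℝ} (h0 : 0 < Q) (h1 : Q < 1) (m : ℤ) : gQ Q (m - 1) = (1 - Q ^ m) * gQ Q m := by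
  rcases lt_trichotomy m 0 with h | h | h
  · rw [gQ, gQ, if_neg (by omega), if_neg (by omega), mul_zero]
  · subst h
    simp [gQ]
  · obtain ⟨k, rfl⟩ : ∃ k : ℕ, m = k + 1 := ⟨(m - 1).toNat, by omega⟩
    rw [gQ, gQ, if_pos (by omega), if_pos (by omega), show ((k : ℤ) + 1 - 1).toNat = k by omega,
      show ((k : ℤ) + 1).toNat = k + 1 by omega]
    have e : qP Q (k + 1) = qP Q k * (1 - Q ^ (k + 1)) := Finset.prod_range_succ _ _
    have h2 := qP_pos h0 h1 k
    have h3 := qP_pos h0 h1 (k + 1)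
    have e2 : (Q : ℝ) ^ ((k : ℤ) + 1) = Q ^ (k + 1) := by norm_cast
    rw [e2]
    field_simp
    rw [e]

lemma qP_lim {Q : ℝ} (h0 : 0 < Q) (h1 : Q < 1) : ∃ p, 0 < p ∧ Tendsto (qP Q) atTop (𝓝 p) := by
  have hs : Summable fun i : ℕ => -(Q ^ (i + 1)) :=
    (((summable_geometric_of_lt_one h0.le h1).mul_left Q).congr fun i => by rw [pow_succ']).neg
  have hm := Real.multipliable_one_add_of_summable hs
  have ht := hm.hasProd.tendsto_prod_nat
  have hne := tprod_one_add_ne_zero_of_summable (f := fun i : ℕ => -(Q ^ (i + 1))) ?_ hs.norm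
  · have h2 : Tendsto (qP Q) atTop (𝓝 (∏' i : ℕ, (1 + -(Q ^ (i + 1))))) := by
      refine ht.congr fun n => ?_
      simp [qP, sub_eq_add_neg]
    refine ⟨_, lt_of_le_of_ne ?_ hne.symm, h2⟩
    exact ge_of_tendsto' h2 fun n => (qP_pos h0 h1 n).le
  · intro i
    have : Q ^ (i + 1) < 1 := pow_lt_one₀ h0.le h1 (by omega)
    have : 0 < 1 + -(Q ^ (i + 1)) := by linarith
    exact this.ne'

lemma gQ_nonneg {Q : ℝ} (h0 : 0 < Q) (h1 : Q < 1) (m : ℤ) : 0 ≤ gQ Q m := by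
  rw [gQ]; split_ifs
  · exact (inv_pos.2 (qP_pos h0 h1 _)).le
  · exact le_rfl

lemma gQ_lim {Q : ℝ} (h0 : 0 < Q) (h1 : Q < 1) :
    ∃ g, 0 < g ∧ Tendsto (gQ Q) atTop (𝓝 g) ∧ ∃ M, ∀ m, gQ Q m ≤ M := by
  obtain ⟨p, hp, ht⟩ := qP_lim h0 h1
  have ht2 := ht.inv₀ hp.ne'
  refine ⟨p⁻¹, by positivity, ?_, ?_⟩
  · have h2 : Tendsto Int.toNat atTop atTop := by
      rw [tendsto_atTop]
      intro b
      filter_upwards [eventually_ge_atTop (b : ℤ)] with a ha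
      omega
    refine (ht2.comp h2).congr' ?_
    filter_upwards [eventually_ge_atTop (0 : ℤ)] with m hm
    simp [gQ, hm]
  · obtain ⟨M, hM⟩ := ht2.bddAbove_range
    refine ⟨max M 0, fun m => ?_⟩
    rw [gQ]; split_ifs
    · exact le_max_of_le_left (hM ⟨_, rfl⟩)
    · exact le_max_right _ _

noncomputable def tq (z y : ℝ) (n : ℤ) (j : ℤ) : ℝ :=
  z ^ j * (gQ (Real.exp (-(2 * π * y))) (n - j) * gQ (Real.exp (-(2 * π * y))) (n + j)) *
    Real.exp (-(π * (j : ℝ) ^ 2) * y)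

lemma expQ {y : ℝ} (hy : 0 < y) : Real.exp (-(2 * π * y)) < 1 := by
  rw [Real.exp_lt_one_iff]
  have := Real.pi_pos
  have : 0 < 2 * π * y := by positivity
  linarith

lemma tq_bound {z y : ℝ} (hz : z = 1 ∨ z = -1) (hy : 0 < y) :
    ∃ M, ∀ n j, ‖tq z y n j‖ ≤ M * Real.exp (-(π * (j : ℝ) ^ 2) * y) := by
  obtain ⟨g, hg, -, M, hM⟩ := gQ_lim (Real.exp_pos (-(2 * π * y))) (expQ hy)
  refine ⟨M * M, fun n j => ?_⟩
  have hz1 : ‖z ^ j‖ = 1 := by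
    rcases hz with rfl | rfl <;> simp
  have h1 := gQ_nonneg (Real.exp_pos (-(2 * π * y))) (expQ hy)
  rw [tq, norm_mul, norm_mul, hz1, one_mul, norm_mul, norm_of_nonneg (h1 _), norm_of_nonneg (h1 _),
    norm_of_nonneg (Real.exp_pos _).le]
  have := hM (n - j)
  have := hM (n + j)
  have := h1 (n - j)
  have := h1 (n + j)
  gcongr
  linarith

lemma tq_summable {z y : ℝ} (hz : z = 1 ∨ z = -1) (hy : 0 < y) (n : ℤ) : Summable (tq z y n) := by
  obtain ⟨M, hM⟩ := tq_bound hz hy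
  exact Summable.of_norm_bounded ((T3_summable hy).mul_left M) (hM n)

lemma tq_rec {z y : ℝ} (hz : z = 1 ∨ z = -1) (hy : 0 < y) (n j : ℤ) :
    (1 - Real.exp (-(2 * π * y)) ^ (2 * n + 1)) * (1 - Real.exp (-(2 * π * y)) ^ (2 * n + 2)) *
      tq z y (n + 1) j = (1 + Real.exp (-(2 * π * y)) ^ (2 * n + 1)) * tq z y n j +
      z * Real.exp (-(π * (2 * n + 1) * y)) * (tq z y n (j - 1) + tq z y n (j + 1)) := by
  have hz2 : z * z = 1 := by rcases hz with rfl | rfl <;> norm_num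
  have hz0 : z ≠ 0 := by rintro rfl; norm_num at hz2
  have hQ : 0 < Real.exp (-(2 * π * y)) := Real.exp_pos _
  have hE1 : Real.exp (-(π * (2 * n + 1) * y)) * Real.exp (-(π * ((j - 1 : ℤ) : ℝ) ^ 2) * y) =
      Real.exp (-(2 * π * y)) ^ (n + 1 - j) * Real.exp (-(π * (j : ℝ) ^ 2) * y) := by
    rw [exp_zpow', ← Real.exp_add, ← Real.exp_add]; congr 1; push_cast; ring
  have hE2 : Real.exp (-(π * (2 * n + 1) * y)) * Real.exp (-(π * ((j + 1 : ℤ) : ℝ) ^ 2) * y) =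
      Real.exp (-(2 * π * y)) ^ (n + 1 + j) * Real.exp (-(π * (j : ℝ) ^ 2) * y) := by
    rw [exp_zpow', ← Real.exp_add, ← Real.exp_add]; congr 1; push_cast; ring
  unfold tq
  have hz3 : z * z ^ (j - 1) = z ^ j := by rw [zpow_sub_one₀ hz0]; field_simp
  have hz4 : z * z ^ (j + 1) = z ^ j := by
    rw [zpow_add_one₀ hz0]; linear_combination z ^ j * hz2
  have r := gQ_rec hQ (expQ hy)
  generalize Real.exp (-(2 * π * y)) = Q at *
  have g1 := r (n + 1 - j)
  have g2 := r (n + 1 + j)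
  have g3 := r (n + j)
  have g4 := r (n - j)
  rw [show n + 1 - j - 1 = n - j by ring] at g1
  rw [show n + 1 + j - 1 = n + j by ring] at g2
  have hx1 : Q ^ (n + j) = Q ^ (n + 1 + j) / Q := by
    rw [show n + 1 + j = n + j + 1 by ring, zpow_add_one₀ hQ.ne']; field_simp
  have hx2 : Q ^ (n - j) = Q ^ (n + 1 - j) / Q := by
    rw [show n + 1 - j = n - j + 1 by ring, zpow_add_one₀ hQ.ne']; field_simp
  have hx3 : Q ^ (2 * n + 2) = Q ^ (n + 1 - j) * Q ^ (n + 1 + j) := by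
    rw [← zpow_add₀ hQ.ne']; congr 1; ring
  have hx4 : Q ^ (2 * n + 1) = Q ^ (n + 1 - j) * Q ^ (n + 1 + j) / Q := by
    rw [eq_div_iff hQ.ne', ← hx3, ← zpow_add_one₀ hQ.ne']; congr 1; ring
  rw [hx3, hx4, show n - (j - 1) = n + 1 - j by ring, show n + (j - 1) = n + j - 1 by ring,
    show n - (j + 1) = n - j - 1 by ring, show n + (j + 1) = n + 1 + j by ring, g3, g4, g1, g2, hx1, hx2]
  generalize gQ Q (n + 1 - j) = x at *
  generalize gQ Q (n + 1 + j) = w at *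
  generalize Q ^ (n + 1 - j) = α at *
  generalize Q ^ (n + 1 + j) = β at *
  generalize Real.exp (-(π * (2 * n + 1) * y)) = E at *
  generalize Real.exp (-(π * ((j - 1 : ℤ) : ℝ) ^ 2) * y) = E1 at *
  generalize Real.exp (-(π * ((j + 1 : ℤ) : ℝ) ^ 2) * y) = E2 at *
  generalize Real.exp (-(π * (j : ℝ) ^ 2) * y) = E0 at *
  have k1 : z * E * (z ^ (j - 1) * (x * ((1 - β / Q) * ((1 - β) * w))) * E1) =
      z ^ j * (x * ((1 - β / Q) * ((1 - β) * w))) * (α * E0) := by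
    rw [← hE1, ← hz3]; ring
  have k2 : z * E * (z ^ (j + 1) * ((1 - α / Q) * ((1 - α) * x) * w) * E2) =
      z ^ j * ((1 - α / Q) * ((1 - α) * x) * w) * (β * E0) := by
    rw [← hE2, ← hz4]; ring
  rw [mul_add, k1, k2]
  ring

lemma sum_rec_aux (f F : ℤ → ℝ) (L A B : ℝ) (s : Summable f)
    (h : ∀ j, L * F j = A * f j + B * (f (j - 1) + f (j + 1))) :
    L * ∑' j, F j = (A + 2 * B) * ∑' j, f j := by
  have s1 : Summable fun j => f (j - 1) := (Equiv.subRight (1:ℤ)).summable_iff.2 s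
  have s2 : Summable fun j => f (j + 1) := (Equiv.addRight (1:ℤ)).summable_iff.2 s
  have t1 : ∑' j, f (j - 1) = ∑' j, f j := (Equiv.subRight (1:ℤ)).tsum_eq f
  have t2 : ∑' j, f (j + 1) = ∑' j, f j := (Equiv.addRight (1:ℤ)).tsum_eq f
  rw [← tsum_mul_left, tsum_congr h, (s.mul_left _).tsum_add ((s1.add s2).mul_left _),
    tsum_mul_left, tsum_mul_left, s1.tsum_add s2, t1, t2]
  ring

lemma tq_sum_rec {z y : ℝ} (hz : z = 1 ∨ z = -1) (hy : 0 < y) (n : ℕ) :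
    (1 - Real.exp (-(2 * π * y)) ^ (2 * (n : ℤ) + 1)) * (1 - Real.exp (-(2 * π * y)) ^ (2 * (n : ℤ) + 2)) *
      (∑' j, tq z y ((n : ℤ) + 1) j) =
      (1 + z * Real.exp (-(π * (2 * (n : ℝ) + 1) * y))) ^ 2 * ∑' j, tq z y (n : ℤ) j := by
  have hz2 : z * z = 1 := by rcases hz with rfl | rfl <;> norm_num
  rw [sum_rec_aux (tq z y (n : ℤ)) (tq z y ((n : ℤ) + 1)) _ _ _ (tq_summable hz hy n) (tq_rec hz hy (n : ℤ))]
  have e : Real.exp (-(2 * π * y)) ^ (2 * (n : ℤ) + 1) = Real.exp (-(π * (2 * (n : ℝ) + 1) * y)) ^ 2 := by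
    rw [exp_zpow', ← Real.exp_nat_mul]; congr 1; push_cast; ring
  rw [e, Int.cast_natCast]
  generalize (∑' j, tq z y (n : ℤ) j) = S
  generalize Real.exp (-(π * (2 * (n : ℝ) + 1) * y)) = x
  linear_combination -S * x ^ 2 * hz2

lemma tq_zero (z y : ℝ) : ∑' j, tq z y 0 j = 1 := by
  rw [tsum_eq_single 0]
  · simp [tq, gQ, qP]
  · intro j hj
    rw [tq]
    rcases lt_or_gt_of_ne hj with h | h
    · have : gQ (Real.exp (-(2 * π * y))) (0 + j) = 0 := by rw [gQ, if_neg (by omega)]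
      rw [this]; simp
    · have : gQ (Real.exp (-(2 * π * y))) (0 - j) = 0 := by rw [gQ, if_neg (by omega)]
      rw [this]; simp

lemma tq_lim {z y g : ℝ} (hz : z = 1 ∨ z = -1) (hy : 0 < y)
    (hg : Tendsto (gQ (Real.exp (-(2 * π * y)))) atTop (𝓝 g)) :
    Tendsto (fun n : ℕ => ∑' j, tq z y n j) atTop
      (𝓝 (g * g * ∑' j : ℤ, z ^ j * Real.exp (-(π * (j : ℝ) ^ 2) * y))) := by
  obtain ⟨M, hM⟩ := tq_bound hz hy
  rw [← tsum_mul_left]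
  refine tendsto_tsum_of_dominated_convergence ((T3_summable hy).mul_left M) ?_
    (Eventually.of_forall fun n j => hM n j)
  intro j
  have h1 : Tendsto (fun n : ℕ => (n : ℤ) - j) atTop atTop :=
    tendsto_atTop_add_const_right _ _ tendsto_natCast_atTop_atTop
  have h2 : Tendsto (fun n : ℕ => (n : ℤ) + j) atTop atTop :=
    tendsto_atTop_add_const_right _ _ tendsto_natCast_atTop_atTop
  have := (((hg.comp h1).mul (hg.comp h2)).const_mul (z ^ j)).mul_const
    (Real.exp (-(π * (j : ℝ) ^ 2) * y))
  rw [show g * g * (z ^ j * Real.exp (-(π * (j : ℝ) ^ 2) * y)) =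
    z ^ j * (g * g) * Real.exp (-(π * (j : ℝ) ^ 2) * y) by ring]
  exact this

lemma T4_eq {y : ℝ} (hy : 0 < y) :
    T4 y = ∑' n : ℤ, (-1 : ℝ) ^ n * Real.exp (-(π * (n : ℝ) ^ 2) * y) := by
  have hs := T3_summable hy
  have hs' : Summable fun n : ℤ => (-1 : ℝ) ^ n * Real.exp (-(π * (n : ℝ) ^ 2) * y) := by
    refine Summable.of_norm_bounded hs fun n => ?_
    rw [norm_mul, norm_of_nonneg (Real.exp_pos _).le]; simp
  have a := tsum_split inj_even inj_odd compl_even_odd hs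
  have b := tsum_split inj_even inj_odd compl_even_odd hs'
  have e : T3 (4 * y) = ∑' n : ℤ, Real.exp (-(π * ((2 * n : ℤ) : ℝ) ^ 2) * y) := by
    rw [T3_eq]; congr 1; ext n; congr 1; push_cast; ring
  have c1 : ∀ n : ℤ, (-1 : ℝ) ^ (2 * n) = 1 := fun n => by
    rw [zpow_mul]; norm_num
  have c2 : ∀ n : ℤ, (-1 : ℝ) ^ (2 * n + 1) = -1 := fun n => by
    rw [zpow_add_one₀ (by norm_num), c1]; norm_num
  simp only [c1, c2, one_mul, neg_mul, tsum_neg] at b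
  simp only [neg_mul] at a e
  have e0 : T3 y = ∑' n : ℤ, Real.exp (-(π * (n : ℝ) ^ 2 * y)) := by
    rw [T3_eq]; simp only [neg_mul]
  have : T4 y = 2 * T3 (4 * y) - T3 y := rfl
  rw [this, e0, a, e]
  simp only [neg_mul]
  rw [b]; ring

lemma ratio_prod {y : ℝ} (hy : 0 < y) : Tendsto (fun n : ℕ => ∏ k ∈ Finset.range n,
    ((1 - Real.exp (-(π * (2 * k + 1) * y))) / (1 + Real.exp (-(π * (2 * k + 1) * y)))) ^ 2)
    atTop (𝓝 (T4 y / T3 y)) := by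
  obtain ⟨g, hg, hlim, -⟩ := gQ_lim (Real.exp_pos (-(2 * π * y))) (expQ hy)
  have l1 := tq_lim (z := 1) (Or.inl rfl) hy hlim
  have l2 := tq_lim (z := -1) (Or.inr rfl) hy hlim
  simp only [one_zpow, one_mul] at l1
  rw [← T3_eq] at l1
  rw [← T4_eq hy] at l2
  have h3 := T3_pos hy
  have l := l2.div l1 (by positivity)
  rw [mul_div_mul_left _ _ (by positivity)] at l
  refine l.congr fun n => ?_
  simp only [Pi.div_apply]
  have hQ := expQ hy
  have hQ0 := Real.exp_pos (-(2 * π * y))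
  have key : ∀ n : ℕ, 0 < ∑' j, tq 1 y n j ∧ (∑' j, tq (-1) y n j) = (∏ k ∈ Finset.range n,
    ((1 - Real.exp (-(π * (2 * k + 1) * y))) / (1 + Real.exp (-(π * (2 * k + 1) * y)))) ^ 2) *
      ∑' j, tq 1 y n j := by
    intro n
    induction n with
    | zero => simp [tq_zero]
    | succ n ih =>
      have r1 := tq_sum_rec (z := 1) (Or.inl rfl) hy n
      have r2 := tq_sum_rec (z := -1) (Or.inr rfl) hy n
      have p1 : 0 < 1 - Real.exp (-(2 * π * y)) ^ (2 * (n : ℤ) + 1) := by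
        have : Real.exp (-(2 * π * y)) ^ (2 * (n : ℤ) + 1) < 1 :=
          zpow_lt_one₀ hQ0 hQ (by omega)
        linarith
      have p2 : 0 < 1 - Real.exp (-(2 * π * y)) ^ (2 * (n : ℤ) + 2) := by
        have : Real.exp (-(2 * π * y)) ^ (2 * (n : ℤ) + 2) < 1 :=
          zpow_lt_one₀ hQ0 hQ (by omega)
        linarith
      have p := mul_pos p1 p2
      generalize (1 - Real.exp (-(2 * π * y)) ^ (2 * (n : ℤ) + 1)) *
        (1 - Real.exp (-(2 * π * y)) ^ (2 * (n : ℤ) + 2)) = lam at *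
      have hx := Real.exp_pos (-(π * (2 * n + 1) * y))
      rw [Finset.prod_range_succ]
      push_cast
      generalize Real.exp (-(π * (2 * n + 1) * y)) = x at *
      obtain ⟨ih1, ih2⟩ := ih
      have s1 : ∑' j, tq 1 y (n + 1) j = (1 + x) ^ 2 * (∑' j, tq 1 y n j) / lam := by
        field_simp; linear_combination r1
      have s2 : ∑' j, tq (-1) y (n + 1) j = (1 - x) ^ 2 * (∑' j, tq (-1) y n j) / lam := by
        field_simp; linear_combination r2
      refine ⟨by rw [s1]; positivity, ?_⟩
      rw [s1, s2, ih2]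
      generalize (∏ k ∈ Finset.range n, ((1 - Real.exp (-(π * (2 * (k:ℝ) + 1) * y))) /
        (1 + Real.exp (-(π * (2 * (k:ℝ) + 1) * y)))) ^ 2) = PP
      field_simp
  rw [(key n).2, mul_div_cancel_right₀ _ (key n).1.ne']

open Real MeasureTheory intervalIntegral Complex
open Filter Topology Set

noncomputable def ck (k : ℕ) : ℝ := π * (2 * k + 1)
lemma ck_pos (k : ℕ) : 0 < ck k := by unfold ck; positivity
lemma pi_le_ck (k : ℕ) : π ≤ ck k := by
  unfold ck
  have := Real.pi_pos
  have h : (0:ℝ) ≤ k := by positivity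
  nlinarith

noncomputable def hk (k : ℕ) (y : ℝ) : ℝ :=
  2 * (Real.log (1 + Real.exp (-(ck k * y))) - Real.log (1 - Real.exp (-(ck k * y))))

lemma hk_hasSum {y : ℝ} (hy : 0 < y) : HasSum (fun k => hk k y) (-Real.log (T4 y / T3 y)) := by
  have hx : ∀ k, Real.exp (-(ck k * y)) < 1 := fun k => by
    rw [Real.exp_lt_one_iff]; have := mul_pos (ck_pos k) hy; linarith
  rw [hasSum_iff_tendsto_nat_of_nonneg]
  · have h := ((Real.continuousAt_log (div_pos (T4_pos hy) (T3_pos hy)).ne').tendsto.comp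
      (ratio_prod hy)).neg
    refine h.congr fun n => ?_
    simp only [Function.comp_def]
    rw [Real.log_prod, ← Finset.sum_neg_distrib]
    · refine Finset.sum_congr rfl fun k _ => ?_
      have h1 := hx k
      have h2 := Real.exp_pos (-(ck k * y))
      rw [hk]
      unfold ck at *
      rw [Real.log_pow, Real.log_div (by linarith) (by linarith)]
      push_cast; ring
    · intro k _
      have h1 := hx k
      have h2 := Real.exp_pos (-(ck k * y))
      unfold ck at *
      have h3 : 0 < 1 - Real.exp (-(π * (2 * k + 1) * y)) := by linarith
      positivity
  · intro k
    have h1 := hx k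
    have h2 := Real.exp_pos (-(ck k * y))
    have := Real.log_le_log (x := 1 - Real.exp (-(ck k * y))) (y := 1 + Real.exp (-(ck k * y)))
      (by linarith) (by linarith)
    rw [hk]; linarith

lemma hk_d (k : ℕ) {y : ℝ} (hy : 0 < y) :
    HasDerivAt (hk k) (-(2 * ck k / Real.sinh (ck k * y))) y := by
  have hc := mul_pos (ck_pos k) hy
  have hx : Real.exp (-(ck k * y)) < 1 := by
    rw [Real.exp_lt_one_iff]; linarith
  have hx0 := Real.exp_pos (-(ck k * y))
  have he : HasDerivAt (fun y => Real.exp (-(ck k * y))) (Real.exp (-(ck k * y)) * (-(ck k * 1))) y :=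
    (((hasDerivAt_id y).const_mul (ck k)).neg).exp
  have h1 := (he.const_add 1).log (by linarith)
  have h2 := (he.const_sub 1).log (by linarith)
  have h := (h1.sub h2).const_mul 2
  convert! h using 1
  rw [Real.sinh_eq]
  have e : Real.exp (ck k * y) = (Real.exp (-(ck k * y)))⁻¹ := by rw [← Real.exp_neg, neg_neg]
  rw [e]
  generalize Real.exp (-(ck k * y)) = x at *
  have a1 : 1 - x ≠ 0 := by linarith
  have a2 : 1 + x ≠ 0 := by linarith
  have a3 : 1 - x ^ 2 ≠ 0 := by
    rw [show 1 - x ^ 2 = (1 - x) * (1 + x) by ring]; exact mul_ne_zero a1 a2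
  field_simp
  ring

lemma sinh_bd {y0 : ℝ} (h0 : 0 < y0) (k : ℕ) {y : ℝ} (hy : y0 ≤ y) :
    (Real.sinh (ck k * y))⁻¹ ≤ 2 / (1 - Real.exp (-(2 * π * y0))) * Real.exp (-(ck k * y0)) := by
  have hd : 0 < 1 - Real.exp (-(2 * π * y0)) := by have := expQ h0; linarith
  have h1 : Real.sinh (ck k * y0) ≤ Real.sinh (ck k * y) := by
    rw [Real.sinh_le_sinh]; exact mul_le_mul_of_nonneg_left hy (ck_pos k).le
  have h2 : Real.exp (ck k * y0) * (1 - Real.exp (-(2 * π * y0))) / 2 ≤ Real.sinh (ck k * y0) := by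
    rw [Real.sinh_eq]
    have : Real.exp (-(ck k * y0)) ≤ Real.exp (ck k * y0) * Real.exp (-(2 * π * y0)) := by
      rw [← Real.exp_add, Real.exp_le_exp]
      have := mul_le_mul_of_nonneg_right (pi_le_ck k) h0.le
      linarith
    linarith
  have h3 : 0 < Real.exp (ck k * y0) * (1 - Real.exp (-(2 * π * y0))) / 2 := by positivity
  calc (Real.sinh (ck k * y))⁻¹ ≤ (Real.exp (ck k * y0) * (1 - Real.exp (-(2 * π * y0))) / 2)⁻¹ :=
        inv_anti₀ h3 (h2.trans h1)
    _ = _ := by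
      rw [Real.exp_neg (ck k * y0)]
      field_simp

lemma ck_exp_summable (p : ℕ) {y0 : ℝ} (h0 : 0 < y0) :
    Summable fun k => ck k ^ p * Real.exp (-(ck k * y0)) := by
  have hr : ‖Real.exp (-(2 * π * y0))‖ < 1 := by
    rw [norm_of_nonneg (Real.exp_pos _).le]; exact expQ h0
  have s := (summable_pow_mul_geometric_of_norm_lt_one p hr).comp_injective (add_left_injective 1)
  refine Summable.of_norm_bounded (s.mul_left ((2 * π) ^ p * Real.exp (2 * π * y0))) fun k => ?_
  have hp := Real.pi_pos
  rw [norm_of_nonneg (by have := ck_pos k; positivity)]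
  simp only [Function.comp_def]
  have e1 : ck k ≤ 2 * π * ((k + 1 : ℕ) : ℝ) := by unfold ck; push_cast; linarith
  have e2 : Real.exp (-(ck k * y0)) ≤ Real.exp (2 * π * y0) * Real.exp (-(2 * π * y0)) ^ (k + 1) := by
    rw [← Real.exp_nat_mul, ← Real.exp_add, Real.exp_le_exp]
    unfold ck; push_cast
    have := mul_pos hp h0
    linarith
  calc _ ≤ (2 * π * ((k + 1 : ℕ) : ℝ)) ^ p * (Real.exp (2 * π * y0) * Real.exp (-(2 * π * y0)) ^ (k + 1)) := by
        have := ck_pos k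
        gcongr
    _ = _ := by rw [mul_pow]; ring

lemma T2_pow4 {y : ℝ} (hy : 0 < y) :
    T2 y ^ 4 = 8 * ∑' k : ℕ, (2 * (k : ℝ) + 1) / Real.sinh (ck k * y) := by
  have h0 : 0 < y / 2 := by positivity
  have hmem : y ∈ Ioi (y / 2) := by simp only [mem_Ioi]; linarith
  have hsum := ((ck_exp_summable 1 h0).mul_left (2 * (2 / (1 - Real.exp (-(2 * π * (y / 2)))))))
  have h := hasDerivAt_tsum_of_isPreconnected (𝕜 := ℝ) (F := ℝ) (g := hk)
    (g' := fun k y => -(2 * ck k / Real.sinh (ck k * y))) hsum isOpen_Ioi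
    (isPreconnected_Ioi (a := y / 2)) (fun k z hz => hk_d k (h0.trans hz)) ?_ hmem
    (hk_hasSum hy).summable hmem
  · have h2 : HasDerivAt (fun z => -Real.log (T4 z / T3 z)) (-(qB y - qC y)) y := by
      have a := (T4_d hy).log (T4_pos hy).ne'
      have b := (T3_d hy).log (T3_pos hy).ne'
      have c := (a.sub b).neg
      refine HasDerivAt.congr_of_eventuallyEq c ?_
      filter_upwards [Ioi_mem_nhds hy] with z hz
      rw [Real.log_div (T4_pos hz).ne' (T3_pos hz).ne']; rfl
    have h3 : HasDerivAt (fun z => ∑' k, hk k z) (-(qB y - qC y)) y := by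
      refine h2.congr_of_eventuallyEq ?_
      filter_upwards [Ioi_mem_nhds hy] with z hz
      exact (hk_hasSum hz).tsum_eq
    have e := h.unique h3
    rw [BC hy, tsum_neg, neg_inj] at e
    have e2 : ∀ k : ℕ, 2 * ck k / Real.sinh (ck k * y) =
        2 * π * ((2 * (k : ℝ) + 1) / Real.sinh (ck k * y)) := fun k => by
      rw [show 2 * ck k = 2 * π * (2 * (k : ℝ) + 1) by unfold ck; ring, mul_div_assoc]
    rw [tsum_congr e2, tsum_mul_left] at e
    have hp := Real.pi_pos
    have : π * (T2 y ^ 4 - 8 * ∑' k : ℕ, (2 * (k : ℝ) + 1) / Real.sinh (ck k * y)) = 0 := by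
      linear_combination (-4) * e
    rcases mul_eq_zero.1 this with h | h
    · exact absurd h hp.ne'
    · linarith
  · intro k z hz
    have hz0 : 0 < z := h0.trans hz
    have hs : 0 < Real.sinh (ck k * z) := Real.sinh_pos_iff.2 (mul_pos (ck_pos k) hz0)
    have := ck_pos k
    rw [norm_neg, norm_of_nonneg (by positivity), div_eq_mul_inv]
    calc _ ≤ 2 * ck k * (2 / (1 - Real.exp (-(2 * π * (y / 2)))) * Real.exp (-(ck k * (y / 2)))) := by
          gcongr; exact sinh_bd h0 k (le_of_lt hz)
      _ = _ := by ring

open Real MeasureTheory intervalIntegral Complex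
open Filter Topology Set

lemma sq_summable {a : ℝ} (ha : 0 < a) : Summable fun n : ℤ => 1 / (a ^ 2 + (n : ℝ) ^ 2) := by
  have h := Real.summable_one_div_int_pow (p := 2).2 (by norm_num)
  refine Summable.of_norm_bounded_eventually h ?_
  filter_upwards [(Set.finite_singleton (0:ℤ)).compl_mem_cofinite] with n hn
  have hn' : (n : ℝ) ≠ 0 := by simpa using hn
  rw [norm_of_nonneg (by positivity)]
  have : 0 < (n : ℝ) ^ 2 := by positivity
  apply one_div_le_one_div_of_le this
  nlinarith [sq_nonneg a]

lemma coth_sum {a : ℝ} (ha : 0 < a) :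
    ∑' n : ℤ, 1 / (a ^ 2 + (n : ℝ) ^ 2) = π / a * (Real.cosh (π * a) / Real.sinh (π * a)) := by
  have hp := Real.pi_pos
  have s := sq_summable ha
  have s1 : Summable fun n : ℕ => 1 / (a ^ 2 + (((n : ℤ) + 1 : ℤ) : ℝ) ^ 2) :=
    s.comp_injective (i := fun n : ℕ => (n : ℤ) + 1) (fun x y h => by simpa using h)
  have s2 : Summable fun n : ℕ => 1 / (a ^ 2 + ((-((n : ℤ) + 1) : ℤ) : ℝ) ^ 2) :=
    s.comp_injective (i := fun n : ℕ => -((n : ℤ) + 1)) (fun x y h => by simpa using h)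
  have e := tsum_of_add_one_of_neg_add_one (f := fun n : ℤ => 1 / (a ^ 2 + (n : ℝ) ^ 2)) s1 s2
  simp only [Int.cast_neg, neg_sq, Int.cast_zero] at e
  have hz : ((a : ℂ) * Complex.I) ∈ Complex.integerComplement := by
    have := UpperHalfPlane.coe_mem_integerComplement ⟨(a : ℂ) * Complex.I, by simpa using ha⟩
    simpa using this
  have c := cot_series_rep' hz
  have hsinh : 0 < Real.sinh (π * a) := Real.sinh_pos_iff.2 (by positivity)
  have ec : Complex.cot ((π : ℂ) * (a * Complex.I)) =
      -(((Real.cosh (π * a) / Real.sinh (π * a) : ℝ) : ℂ) * Complex.I) := by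
    rw [Complex.cot, ← mul_assoc, Complex.cos_mul_I, Complex.sin_mul_I]
    push_cast
    have : Complex.sinh ((π : ℂ) * a) ≠ 0 := by
      rw [← Complex.ofReal_mul, ← Complex.ofReal_sinh]; exact_mod_cast hsinh.ne'
    field_simp
    simp
  have et : ∀ n : ℕ, 1 / ((a : ℂ) * Complex.I - (n + 1)) + 1 / ((a : ℂ) * Complex.I + (n + 1)) =
      (-(2 * a * Complex.I)) * ((1 / (a ^ 2 + (((n : ℤ) + 1 : ℤ) : ℝ) ^ 2) : ℝ) : ℂ) := by
    intro n
    have n1 : (a : ℂ) * Complex.I - (n + 1) ≠ 0 := by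
      intro h; have := congrArg Complex.im h; simp at this; exact ha.ne' this
    have n2 : (a : ℂ) * Complex.I + (n + 1) ≠ 0 := by
      intro h; have := congrArg Complex.im h; simp at this; exact ha.ne' this
    have n3 : (a : ℂ) ^ 2 + (n + 1) ^ 2 ≠ 0 := by
      have : 0 < a ^ 2 + ((n : ℝ) + 1) ^ 2 := by positivity
      exact_mod_cast this.ne'
    push_cast
    rw [div_add_div _ _ n1 n2, mul_one_div, div_eq_div_iff (mul_ne_zero n1 n2) n3]
    linear_combination (2 * (a : ℂ) ^ 3 * Complex.I) * Complex.I_sq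
  rw [tsum_congr et, tsum_mul_left, ← Complex.ofReal_tsum, ec] at c
  rw [e]
  generalize (∑' n : ℕ, 1 / (a ^ 2 + (((n : ℤ) + 1 : ℤ) : ℝ) ^ 2)) = S at *
  have c2 := congrArg Complex.im c
  have ha' : (a : ℂ) ≠ 0 := by exact_mod_cast ha.ne'
  rw [show (1 : ℂ) / (a * Complex.I) = ((-(1 / a) : ℝ) : ℂ) * Complex.I by
    push_cast; field_simp; simp] at c2
  generalize Real.cosh (π * a) / Real.sinh (π * a) = R at *
  have c3 : π * (-R) + 1 / a = -(2 * a) * S := by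
    simpa using c2
  have : π * R = 1 / a + 2 * a * S := by linarith
  rw [div_mul_eq_mul_div, this]
  field_simp
  ring

lemma alt_sum {a : ℝ} (ha : 0 < a) : (∑' n : ℤ, (-1 : ℝ) ^ n * (1 / (a ^ 2 + (n : ℝ) ^ 2))) =
    π / (a * Real.sinh (π * a)) := by
  have hp := Real.pi_pos
  have hs := sq_summable ha
  have hs' : Summable fun n : ℤ => (-1 : ℝ) ^ n * (1 / (a ^ 2 + (n : ℝ) ^ 2)) := by
    refine Summable.of_norm_bounded hs fun n => ?_
    rw [norm_mul, norm_of_nonneg (show 0 ≤ 1 / (a ^ 2 + (n : ℝ) ^ 2) by positivity)]; simp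
  have x := tsum_split inj_even inj_odd compl_even_odd hs
  have b := tsum_split inj_even inj_odd compl_even_odd hs'
  have c1 : ∀ n : ℤ, (-1 : ℝ) ^ (2 * n) = 1 := fun n => by
    rw [zpow_mul]; norm_num
  have c2 : ∀ n : ℤ, (-1 : ℝ) ^ (2 * n + 1) = -1 := fun n => by
    rw [zpow_add_one₀ (by norm_num), c1]; norm_num
  simp only [c1, c2, one_mul, neg_mul, tsum_neg] at b
  have e : ∑' n : ℤ, 1 / (a ^ 2 + ((2 * n : ℤ) : ℝ) ^ 2) =
      1 / 4 * ∑' n : ℤ, 1 / ((a / 2) ^ 2 + (n : ℝ) ^ 2) := by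
    rw [← tsum_mul_left]; congr 1; ext n; push_cast
    rw [show (a ^ 2 + (2 * (n:ℝ)) ^ 2) = 4 * ((a / 2) ^ 2 + (n : ℝ) ^ 2) by ring]
    rw [one_div_mul_one_div]
  rw [e] at b x
  rw [b]
  rw [coth_sum ha] at x
  rw [coth_sum (by positivity)] at b x ⊢
  have e2 : π * a = 2 * (π * (a / 2)) := by ring
  have hsh : 0 < Real.sinh (π * (a / 2)) := Real.sinh_pos_iff.2 (by positivity)
  have hch : 0 < Real.cosh (π * (a / 2)) := Real.cosh_pos _
  have hc := Real.cosh_sq (π * (a / 2))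
  rw [e2, Real.cosh_two_mul, Real.sinh_two_mul] at x
  rw [e2, Real.sinh_two_mul]
  generalize Real.sinh (π * (a / 2)) = sh at *
  generalize Real.cosh (π * (a / 2)) = ch at *
  have : (∑' n : ℤ, 1 / (a ^ 2 + ((2 * n + 1 : ℤ) : ℝ) ^ 2)) =
    π / a * ((ch ^ 2 + sh ^ 2) / (2 * sh * ch)) - 1 / 4 * (π / (a / 2) * (ch / sh)) := by linarith
  rw [this]
  field_simp
  linear_combination 4 * hc

lemma lap_T4 {a : ℝ} (ha : 0 < a) :
    ∫ y in Ioi (0:ℝ), Real.exp (-(π * a ^ 2) * y) * T4 y = 1 / (a * Real.sinh (π * a)) := by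
  have hp := Real.pi_pos
  set F : ℤ → ℝ → ℝ := fun n y => (-1 : ℝ) ^ n * Real.exp (-(π * (a ^ 2 + (n : ℝ) ^ 2)) * y)
  have hneg : ∀ n : ℤ, -(π * (a ^ 2 + (n : ℝ) ^ 2)) < 0 := fun n => by
    have : 0 < π * (a ^ 2 + (n : ℝ) ^ 2) := by positivity
    linarith
  have hint : ∀ n, IntegrableOn (F n) (Ioi 0) := fun n =>
    (integrableOn_exp_mul_Ioi (hneg n) 0).const_mul _
  have hI : ∀ n : ℤ, ∫ y in Ioi (0:ℝ), Real.exp (-(π * (a ^ 2 + (n : ℝ) ^ 2)) * y) =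
      1 / π * (1 / (a ^ 2 + (n : ℝ) ^ 2)) := fun n => by
    rw [integral_exp_mul_Ioi (hneg n)]
    simp
    field_simp
  have hsum : Summable fun n => ∫ y in Ioi (0:ℝ), ‖F n y‖ := by
    refine ((sq_summable ha).mul_left (1 / π)).congr fun n => ?_
    rw [← hI n]
    congr 1; ext y
    simp only [F]
    rw [norm_mul, norm_of_nonneg (Real.exp_pos _).le]; simp
  have h := (hasSum_integral_of_summable_integral_norm hint hsum).tsum_eq
  have e1 : ∫ y in Ioi (0:ℝ), (∑' n, F n y) = ∫ y in Ioi (0:ℝ), Real.exp (-(π * a ^ 2) * y) * T4 y := by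
    refine setIntegral_congr_fun measurableSet_Ioi fun y hy => ?_
    rw [T4_eq hy, ← tsum_mul_left]
    congr 1; ext n
    simp only [F]
    rw [mul_left_comm, ← Real.exp_add]; congr 2; ring
  rw [← e1, ← h]
  have e2 : ∀ n, ∫ y in Ioi (0:ℝ), F n y = 1 / π * ((-1 : ℝ) ^ n * (1 / (a ^ 2 + (n : ℝ) ^ 2))) := fun n => by
    simp only [F]
    rw [MeasureTheory.integral_const_mul, hI]; ring
  rw [tsum_congr e2, tsum_mul_left, alt_sum ha]
  field_simp

lemma RD.sqrt_mul {f : ℝ → ℝ} (hf : RD f) : RD (fun w => √w * f w) := by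
  intro N
  have h : Tendsto (fun w : ℝ => (√w)⁻¹) atTop (𝓝 0) := tendsto_inv_atTop_zero.comp tendsto_sqrt_atTop
  have := (hf (N + 1)).mul h
  simp only [mul_zero] at this
  refine this.congr' ?_
  filter_upwards [eventually_gt_atTop 0] with w hw
  have e : √w ^ 2 = w := Real.sq_sqrt hw.le
  have : √w ≠ 0 := by positivity
  field_simp
  rw [e]; ring

lemma RD.congr_pos {f g : ℝ → ℝ} (hf : RD f) (h : ∀ w, 0 < w → f w = g w) : RD g := by
  intro N
  refine (hf N).congr' ?_
  filter_upwards [eventually_gt_atTop 0] with w hw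
  rw [h w hw]

lemma T4_flat : RD (fun w => T4 (1 / w)) := T2_RD.sqrt_mul.congr_pos fun _ hw => (T4_S hw).symm

lemma D4_flat : RD (fun w => D4 (1 / w)) := by
  have h := (((T2_RD.const_mul (-(1/2))).pow_mul 1).sub (D2_RD.pow_mul 2)).sqrt_mul
  refine h.congr_pos fun w hw => ?_
  rw [D4_S hw]
  field_simp
  ring

lemma exp_inv_lim (s : ℝ) : Tendsto (fun w : ℝ => Real.exp (-s * (1 / w))) atTop (𝓝 1) := by
  have h : Tendsto (fun w : ℝ => -s * (1 / w)) atTop (𝓝 (-s * 0)) := by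
    simpa using (tendsto_inv_atTop_zero (𝕜 := ℝ)).const_mul (-s)
  have := (Real.continuous_exp.tendsto _).comp h
  simpa [Function.comp_def] using this

lemma exp_lim0 {s : ℝ} (hs : 0 < s) : Tendsto (fun y : ℝ => Real.exp (-s * y)) atTop (𝓝 0) := by
  have h : Tendsto (fun y : ℝ => -s * y) atTop atBot := by
    simpa using tendsto_id.const_mul_atTop_of_neg (by linarith : -s < 0)
  exact Real.tendsto_exp_atBot.comp h

lemma exp_RD {s : ℝ} (hs : 0 < s) : RD (fun y => Real.exp (-s * y)) := by
  refine RD_of_exp (c := s) (l := 1) hs ?_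
  refine tendsto_const_nhds.congr fun y => ?_
  rw [← Real.exp_add]; simp

lemma exp_c (s : ℝ) : ContinuousOn (fun y : ℝ => Real.exp (-s * y)) (Ioi 0) := by fun_prop

lemma eD4_int {s : ℝ} (hs : 0 < s) : IntegrableOn (fun y => Real.exp (-s * y) * D4 y) (Ioi 0) := by
  apply intOn ((exp_c s).mul D4_c) ((exp_RD hs).mul_tendsto D4_RD.tendsto)
  simpa using (exp_inv_lim s).mul D4_flat.tendsto

lemma eT4_int {s : ℝ} (hs : 0 < s) : IntegrableOn (fun y => Real.exp (-s * y) * T4 y) (Ioi 0) := by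
  apply intOn ((exp_c s).mul T4_c) ((exp_RD hs).mul_tendsto T4_lim)
  simpa using (exp_inv_lim s).mul T4_flat.tendsto

lemma lap_D4 {a : ℝ} (ha : 0 < a) :
    ∫ y in Ioi (0:ℝ), Real.exp (-(π * a ^ 2) * y) * D4 y = π * a / Real.sinh (π * a) := by
  have hp := Real.pi_pos
  have hs : 0 < π * a ^ 2 := by positivity
  have h := ftc0 (f := fun y => Real.exp (-(π * a ^ 2) * y) * T4 y)
    (f' := fun y => Real.exp (-(π * a ^ 2) * y) * D4 y - (π * a ^ 2) * (Real.exp (-(π * a ^ 2) * y) * T4 y))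
    (a := 0) (m := 0) ?_ (Integrable.sub (eD4_int hs) ((eT4_int hs).const_mul _)) ?_ ?_
  · rw [integral_sub (eD4_int hs) ((eT4_int hs).const_mul _), MeasureTheory.integral_const_mul, lap_T4 ha] at h
    rw [sub_zero] at h
    rw [sub_eq_zero.1 h]
    field_simp
  · intro y hy
    have := (((hasDerivAt_id y).const_mul (-(π * a ^ 2))).exp).mul (T4_d hy)
    convert! this using 1
    simp only [id]
    ring
  · apply tendsto_zero_of_inv
    simpa using (exp_inv_lim (π * a ^ 2)).mul T4_flat.tendsto
  · exact ((exp_RD hs).mul_tendsto T4_lim).tendsto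

open Real MeasureTheory intervalIntegral Complex
open Filter Topology Set

lemma bdd_of {f : ℝ → ℝ} (hc : ContinuousOn f (Ioi 0)) (hi : Tendsto f atTop (𝓝 0))
    (h0 : Tendsto (fun w => f (1 / w)) atTop (𝓝 0)) : ∃ C, 0 ≤ C ∧ ∀ y, 0 < y → |f y| ≤ C := by
  have b1 : ∀ᶠ y in atTop, |f y| ≤ 1 := by
    have := hi.abs
    rw [abs_zero] at this
    exact this.eventually (ge_mem_nhds zero_lt_one)
  have b2 : ∀ᶠ w in atTop, |f (1 / w)| ≤ 1 := by
    have := h0.abs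
    rw [abs_zero] at this
    exact this.eventually (ge_mem_nhds zero_lt_one)
  obtain ⟨A, hA⟩ := eventually_atTop.1 b1
  obtain ⟨B, hB⟩ := eventually_atTop.1 b2
  set B' := max B 1
  have hB' : 0 < B' := lt_max_of_lt_right one_pos
  obtain ⟨C, hC⟩ := (isCompact_Icc (a := 1 / B') (b := A)).exists_bound_of_continuousOn
    (hc.mono fun x hx => lt_of_lt_of_le (by positivity) hx.1)
  refine ⟨max C 1, le_max_of_le_right zero_le_one, fun y hy => ?_⟩
  by_cases h1 : A ≤ y
  · exact (hA y h1).trans (le_max_right _ _)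
  by_cases h2 : y < 1 / B'
  · have : B ≤ 1 / y := by
      have h3 : B' ≤ 1 / y := by
        rw [le_div_iff₀ hy]
        rw [lt_div_iff₀ hB'] at h2
        linarith
      exact (le_max_left _ _).trans h3
    have := hB _ this
    rw [one_div_one_div] at this
    exact this.trans (le_max_right _ _)
  · exact (hC y ⟨not_lt.1 h2, (not_le.1 h1).le⟩).trans (le_max_left _ _)

lemma D4_bdd : ∃ C, 0 ≤ C ∧ ∀ y, 0 < y → |D4 y| ≤ C := bdd_of D4_c D4_RD.tendsto D4_flat.tendsto

lemma D2_bdd : ∃ C, 0 ≤ C ∧ ∀ u, 0 < u → |u ^ 2 * D2 u| ≤ C := by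
  refine bdd_of ((continuousOn_id.pow 2).mul D2_c) (D2_RD 2) ?_
  have h1 : Tendsto (fun w : ℝ => (√w)⁻¹ * (-(1 / 2) * T4 w)) atTop (𝓝 (0 * (-(1/2) * 1))) :=
    (tendsto_inv_atTop_zero.comp tendsto_sqrt_atTop).mul (T4_lim.const_mul _)
  have h2 := h1.sub D4_RD.sqrt_mul.tendsto
  simp only [zero_mul, sub_zero] at h2
  refine h2.congr' ?_
  filter_upwards [eventually_gt_atTop 0] with w hw
  have e : √w ^ 2 = w := Real.sq_sqrt hw.le
  have : √w ≠ 0 := by positivity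
  rw [D2_S hw]
  field_simp
  rw [e]; ring

lemma T2_nat {y : ℝ} (hy : 0 < y) :
    T2 y = ∑' k : ℕ, 2 * Real.exp (-(π * ((k : ℝ) + 1 / 2) ^ 2) * y) := by
  rw [T2_eq hy, ← tsum_nat_add_neg_add_one (T2_summable hy)]
  congr 1; ext k
  push_cast
  rw [show (-((k : ℝ) + 1) + 1 / 2) ^ 2 = ((k : ℝ) + 1 / 2) ^ 2 by ring]
  ring

lemma Psi {v : ℝ} (hv : 0 < v) :
    ∫ y in Ioi (0:ℝ), T2 (v ^ 2 * y) * D4 y = π / 8 * (v * T2 (v / 2) ^ 4) := by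
  have hp := Real.pi_pos
  obtain ⟨C, hC0, hC⟩ := D4_bdd
  set F : ℕ → ℝ → ℝ := fun k y => 2 * (Real.exp (-(π * (((k : ℝ) + 1 / 2) * v) ^ 2) * y) * D4 y)
  have hs : ∀ k : ℕ, 0 < π * (((k : ℝ) + 1 / 2) * v) ^ 2 := fun k => by positivity
  have hint : ∀ n, IntegrableOn (F n) (Ioi 0) := fun n => (eD4_int (hs n)).const_mul 2
  have hsum : Summable fun k => ∫ y in Ioi (0:ℝ), ‖F k y‖ := by
    have h0 : Summable fun k : ℕ => 1 / ((k : ℝ) + 1 / 2) ^ 2 := by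
      refine Summable.of_norm_bounded_eventually_nat (Real.summable_one_div_nat_pow.2 (by norm_num : 1 < 2)) ?_
      filter_upwards [eventually_gt_atTop 0] with k hk
      have : (0:ℝ) < k := by exact_mod_cast hk
      rw [norm_of_nonneg (by positivity)]
      apply one_div_le_one_div_of_le (by positivity)
      gcongr; linarith
    refine Summable.of_norm_bounded (h0.mul_left (2 * C / (π * v ^ 2))) fun k => ?_
    rw [norm_of_nonneg (integral_nonneg fun y => norm_nonneg _)]
    have hneg : -(π * (((k : ℝ) + 1 / 2) * v) ^ 2) < 0 := by have := hs k; linarith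
    have := setIntegral_mono_on (μ := volume) (hint k).norm
      ((integrableOn_exp_mul_Ioi hneg 0).const_mul (2 * C))
      measurableSet_Ioi (fun y hy => ?_)
    · refine this.trans (le_of_eq ?_)
      rw [MeasureTheory.integral_const_mul, integral_exp_mul_Ioi hneg]
      simp only [mul_zero, Real.exp_zero]
      field_simp
    · simp only [F]
      rw [norm_mul, norm_mul, norm_of_nonneg (Real.exp_pos _).le, Real.norm_eq_abs, Real.norm_eq_abs, abs_two]
      have := hC y hy
      have := Real.exp_pos (-(π * (((k : ℝ) + 1 / 2) * v) ^ 2) * y)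
      calc _ ≤ 2 * (Real.exp (-(π * (((k : ℝ) + 1 / 2) * v) ^ 2) * y) * C) := by gcongr
        _ = _ := by ring
  have h := (hasSum_integral_of_summable_integral_norm hint hsum).tsum_eq
  have e1 : ∫ y in Ioi (0:ℝ), (∑' n, F n y) = ∫ y in Ioi (0:ℝ), T2 (v ^ 2 * y) * D4 y := by
    refine setIntegral_congr_fun measurableSet_Ioi fun y hy => ?_
    have hy' : 0 < y := hy
    rw [T2_nat (by positivity : 0 < v ^ 2 * y), ← tsum_mul_right]
    congr 1; ext n
    simp only [F]
    rw [← mul_assoc]; congr 3; ring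
  rw [← e1, ← h, T2_pow4 (by positivity)]
  have e2 : ∀ k : ℕ, ∫ y in Ioi (0:ℝ), F k y =
      π * v * ((2 * (k : ℝ) + 1) / Real.sinh (ck k * (v / 2))) := fun k => by
    simp only [F]
    rw [MeasureTheory.integral_const_mul, lap_D4 (by positivity)]
    rw [show π * (((k : ℝ) + 1 / 2) * v) = ck k * (v / 2) by unfold ck; ring]
    unfold ck; ring
  rw [tsum_congr e2, tsum_mul_left]
  ring

lemma T2D4_int : IntegrableOn (fun y => T2 (1 * y) * D4 y) (Ioi 0) := by
  simp only [one_mul]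
  apply intOn (T2_c.mul D4_c) (T2_RD.mul_tendsto D4_RD.tendsto)
  have h := (D4_flat.sqrt_mul.mul_tendsto T4_lim).tendsto
  refine h.congr' ?_
  filter_upwards [eventually_gt_atTop 0] with w hw
  rw [Pi.mul_apply, T2_S hw]; ring

lemma D4y_int : IntegrableOn (fun y => D4 y / y) (Ioi 0) := by
  apply intOn (D4_c.div continuousOn_id fun x hx => ne_of_gt hx)
  · exact D4_RD.mul_tendsto tendsto_inv_atTop_zero
  · refine (D4_flat 1).congr fun w => ?_
    rw [Pi.div_apply]; simp only [id]; field_simp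

lemma Psi_d : HasDerivAt (fun c => ∫ y in Ioi (0:ℝ), T2 (c * y) * D4 y)
    (∫ y in Ioi (0:ℝ), y * (D2 y * D4 y)) 1 := by
  obtain ⟨C, hC0, hC⟩ := D2_bdd
  have hcomp : ∀ {f : ℝ → ℝ}, ContinuousOn f (Ioi 0) → ∀ {c : ℝ}, 0 < c →
      ContinuousOn (fun y => f (c * y)) (Ioi 0) := fun hf c hc =>
    hf.comp (continuousOn_const.mul continuousOn_id) fun y hy => mul_pos hc hy
  have h := (hasDerivAt_integral_of_dominated_loc_of_deriv_le (𝕜 := ℝ) (μ := volume.restrict (Ioi (0:ℝ)))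
    (F := fun c y => T2 (c * y) * D4 y) (F' := fun c y => y * (D2 (c * y) * D4 y)) (x₀ := 1)
    (s := Ioi (1/2)) (bound := fun y => 4 * C * ‖D4 y / y‖) (Ioi_mem_nhds (by norm_num)) ?_ T2D4_int ?_ ?_
    (D4y_int.norm.const_mul _) ?_).2
  · simpa using h
  · filter_upwards [Ioi_mem_nhds (zero_lt_one' ℝ)] with c hc
    exact ((hcomp T2_c hc).mul D4_c).aestronglyMeasurable measurableSet_Ioi
  · exact (continuousOn_id.mul ((hcomp D2_c one_pos).mul D4_c)).aestronglyMeasurable measurableSet_Ioi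
  · filter_upwards [ae_restrict_mem measurableSet_Ioi] with y hy c hc
    have hy' : 0 < y := hy
    have hc1 : 1 / 2 < c := hc
    have hc' : 0 < c := by linarith
    have := hC (c * y) (by positivity)
    rw [abs_mul, abs_of_pos (by positivity)] at this
    rw [norm_mul, norm_mul, norm_div, norm_of_nonneg hy'.le, Real.norm_eq_abs, Real.norm_eq_abs]
    have h2 : |D2 (c * y)| ≤ C / (c * y) ^ 2 := by
      rw [le_div_iff₀ (by positivity)]; linarith
    have h3 : C / (c * y) ^ 2 ≤ C / (1 / 2 * y) ^ 2 := by gcongr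
    calc _ ≤ y * (C / (1 / 2 * y) ^ 2 * |D4 y|) := by gcongr; exact h2.trans h3
      _ = _ := by field_simp; ring
  · filter_upwards [ae_restrict_mem measurableSet_Ioi] with y hy c hc
    have hy' : 0 < y := hy
    have hc1 : 1 / 2 < c := hc
    have hc' : 0 < c := by linarith
    have := ((T2_d (y := c * y) (by positivity)).comp c ((hasDerivAt_id c).mul_const y)).mul_const (D4 y)
    convert! this using 1
    ring

lemma S_val : ∫ y in Ioi (0:ℝ), y * (D2 y * D4 y) =
    -(π ^ 2 / 8) * (T2 1 ^ 2 * T3 1 ^ 2 * T4 1 ^ 4) := by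
  have hp := Real.pi_pos
  set S := ∫ y in Ioi (0:ℝ), y * (D2 y * D4 y) with hS
  have d1 : HasDerivAt (fun v : ℝ => ∫ y in Ioi (0:ℝ), T2 (v ^ 2 * y) * D4 y) (S * 2) 1 := by
    have h1 : HasDerivAt (fun v : ℝ => v ^ 2) 2 1 := by
      simpa using hasDerivAt_pow 2 (1:ℝ)
    exact HasDerivAt.comp_of_eq (1:ℝ) Psi_d h1 (by norm_num)
  have d2 : HasDerivAt (fun v : ℝ => π / 8 * (v * T2 (v / 2) ^ 4))
      (π / 8 * (1 * T2 (1 / 2) ^ 4 + 1 * (4 * T2 (1 / 2) ^ 3 * (D2 (1 / 2) * (1 / 2))))) 1 := by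
    have h1 := (T2_d (y := 1 / 2) (by norm_num)).comp (1:ℝ) ((hasDerivAt_id (1:ℝ)).div_const 2)
    have h2 := ((hasDerivAt_id (1:ℝ)).mul (h1.pow 4)).const_mul (π / 8)
    convert! h2 using 1
  have d3 := d2.congr_of_eventuallyEq (f₁ := fun v : ℝ => ∫ y in Ioi (0:ℝ), T2 (v ^ 2 * y) * D4 y) ?_
  swap
  · filter_upwards [Ioi_mem_nhds (zero_lt_one' ℝ)] with v hv
    exact Psi hv
  have e := d1.unique d3
  have c1 := dbl23 (y := 1 / 2) (by norm_num)
  have c2 := qA_dbl (y := 1 / 2) (by norm_num)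
  have c3 := qC_S (y := 1) one_pos
  have c4 := AC (y := 1) one_pos
  rw [D2_q (by norm_num)] at e
  norm_num at c1 c2 c3 e
  have c5 : qC 1 = -(1/4) := by linarith
  have c6 : T2 (1/2) ^ 4 = (2 * (T2 1 * T3 1)) ^ 2 := by rw [c1]; ring
  have c7 : qA (1/2) = -(1/2) - π / 4 * T4 1 ^ 4 := by rw [c2]; linarith
  have : S * 2 = π / 8 * (T2 (1/2) ^ 4 * (1 + 2 * qA (1/2))) := by rw [e]; ring
  rw [c6, c7] at this
  linear_combination this / 2

theorem stmt3 :
    (∫ t in (0:ℝ)..1, ellipticK (Real.sqrt (1 - t)) * (ellipticK (Real.sqrt t)) ^ 2 /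
        (2 * t ^ ((3:ℝ)/4) * (1 - t) ^ ((3:ℝ)/4)))
      = Real.Gamma (1/4) ^ 8 / (32 * Real.sqrt 2 * π ^ 2) := by
  have hp := Real.pi_pos
  rw [I_part, S_val]
  have h8 := T3_one
  have h24 := T24_one
  have hj := jac (y := 1) one_pos
  have h3 := T3_pos one_pos
  have h4 := T4_pos one_pos
  rw [h24] at hj ⊢
  have hs2 : √2 ^ 2 = (2:ℝ) := Real.sq_sqrt (by norm_num)
  have hs0 : 0 < √(2:ℝ) := by positivity
  have hq : √2 * T4 1 ^ 2 = T3 1 ^ 2 := by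
    have : (√2 * T4 1 ^ 2) ^ 2 = (T3 1 ^ 2) ^ 2 := by rw [mul_pow, hs2]; linear_combination -hj
    exact (pow_left_inj₀ (by positivity) (by positivity) (by norm_num)).1 this
  have h6 : 2 * √2 * (T4 1 ^ 2 * T3 1 ^ 2 * T4 1 ^ 4) = T3 1 ^ 8 := by
    calc _ = √2 ^ 2 * √2 * (T4 1 ^ 2 * T3 1 ^ 2 * T4 1 ^ 4) := by rw [hs2]
      _ = (√2 * T4 1 ^ 2) ^ 3 * T3 1 ^ 2 := by ring
      _ = _ := by rw [hq]; ring
  rw [h8] at h6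
  generalize T4 1 ^ 2 * T3 1 ^ 2 * T4 1 ^ 4 = X at *
  field_simp at h6 ⊢
  linear_combination h6
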